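/- arXiv:2504.04064 — 4 statements merged into one kernel-verified Lean document; each statement's English description precedes it below -/
import Mathlib

section
/- Fix b̄ ∈ (0,1). There exist C > 0 and p₀ ≥ 4 such that: whenever γ ∈ [1/3,1/2), 0 < α < (1−2γ)/2, α < β < α+γ, and p := 2/(1−2γ+2(β−α)) satisfies p ≥ p₀ and βp ≤ b̄, then the best constant S_γ(α,β) := inf over nonzero u ∈ C_c^∞(ℝ) of [∫_ℝ∫_ℝ (u(x)−u(y))² |x−y|^{−1−2γ}|x|^{−α}|y|^{−α} dx dy] / ( ∫_ℝ |u(x)|^p |x|^{−βp} dx )^{2/p} satisfies S_γ(α,β) ≤ C/p. Moreover, for the same C, if u is a nonnegative measurable function with finite energy ∫_ℝ∫_ℝ (u(x)−u(y))² |x−y|^{−1−2γ}|x|^{−α}|y|^{−α} dx dy < ∞, with 0 < ∫_ℝ u^p |x|^{−βp} dx < ∞, whose CKN quotient equals S_γ(α,β), and which satisfies the energy identity (1/2)∫_ℝ∫_ℝ (u(x)−u(y))² |x−y|^{−1−2γ}|x|^{−α}|y|^{−α} dx dy = (1/p)∫_ℝ u^p |x|^{−βp} dx, then ∫_ℝ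 u(x)^p |x|^{−βp} dx ≤ C. -/
open MeasureTheory Real
open scoped ENNReal

/-- The weighted CKN kernel `|x-y|^{-1-2γ} |x|^{-α} |y|^{-α}` in dimension one. -/
noncomputable def cknK (γ α x y : ℝ) : ℝ :=
  |x - y| ^ (-(1 + 2 * γ)) * (|x| ^ (-α) * |y| ^ (-α))

/-- `u` is a weak solution of `𝓛_{γ,α} u = F` in the open set `I ⊆ ℝ`: for every test
function `φ ∈ C_c^∞(I)`, the symmetrized double integral converges absolutely and
`(1/2) ∫∫ (u(x)-u(y))(φ(x)-φ(y)) K_{γ,α}(x,y) dx dy = ∫ F φ`. -/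
def IsWeakSol (γ α : ℝ) (u F : ℝ → ℝ) (I : Set ℝ) : Prop :=
  ∀ φ : ℝ → ℝ, ContDiff ℝ (⊤ : ℕ∞) φ → HasCompactSupport φ → tsupport φ ⊆ I →
    MeasureTheory.Integrable
      (fun q : ℝ × ℝ => (u q.1 - u q.2) * (φ q.1 - φ q.2) * cknK γ α q.1 q.2) ∧
    (1 / 2) * (∫ q : ℝ × ℝ, (u q.1 - u q.2) * (φ q.1 - φ q.2) * cknK γ α q.1 q.2) =
      ∫ x : ℝ, F x * φ x

/-- The weighted Gagliardo energy
`∫∫ (u(x)-u(y))² |x-y|^{-1-2γ} |x|^{-α}|y|^{-α} dx dy`, as an element of `[0,∞]`. -/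
noncomputable def cknEnergy (γ α : ℝ) (u : ℝ → ℝ) : ℝ≥0∞ :=
  ∫⁻ x : ℝ, ∫⁻ y : ℝ, ENNReal.ofReal ((u x - u y) ^ 2 * cknK γ α x y)

/-- The weighted mass `∫ |u(x)|^p |x|^{-βp} dx`, as an element of `[0,∞]`. -/
noncomputable def cknMass (β p : ℝ) (u : ℝ → ℝ) : ℝ≥0∞ :=
  ∫⁻ x : ℝ, ENNReal.ofReal (|u x| ^ p * |x| ^ (-(β * p)))

/-- The Caffarelli–Kohn–Nirenberg quotient `E[u] = ‖u‖²_{γ,α} / (∫ |u|^p |x|^{-βp})^{2/p}`. -/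
noncomputable def cknQuot (γ α β p : ℝ) (u : ℝ → ℝ) : ℝ :=
  (cknEnergy γ α u).toReal / ((cknMass β p u).toReal) ^ (2 / p)

/-- The best constant `S_γ(α,β)`: infimum of the CKN quotient over nonzero
`u ∈ C_c^∞(ℝ)`. -/
noncomputable def cknS (γ α β p : ℝ) : ℝ :=
  sInf {q : ℝ | ∃ u : ℝ → ℝ, ContDiff ℝ (⊤ : ℕ∞) u ∧ HasCompactSupport u ∧ u ≠ 0 ∧
    q = cknQuot γ α β p u}


/-- Superposition of dilated bumps. -/
noncomputable def cknTower (φ : ℝ → ℝ) : ℕ → ℝ → ℝ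
  | 0 => fun _ => 0
  | n + 1 => fun x => φ x + cknTower φ n (4 * x)

noncomputable def cknW (x : ℝ) : ℝ := 1 + |x| ^ (-(1 / 2) : ℝ)
noncomputable def cknG (x : ℝ) : ℝ := if |x| ≤ 3 then cknW x else 0
noncomputable def cknH (x : ℝ) : ℝ := cknW x * (1 + |x|) ^ (-(5 / 3) : ℝ)

lemma cknW_ge_one (x : ℝ) : 1 ≤ cknW x := by
  unfold cknW
  have : 0 ≤ |x| ^ (-(1 / 2) : ℝ) := by positivity
  linarith

lemma cknG_nonneg (x : ℝ) : 0 ≤ cknG x := by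
  unfold cknG
  split_ifs
  · linarith [cknW_ge_one x]
  · exact le_rfl

lemma cknH_nonneg (x : ℝ) : 0 ≤ cknH x := by
  unfold cknH
  have := cknW_ge_one x
  positivity

lemma cknW_bound {x s : ℝ} (hx : x ≠ 0) (hs0 : 0 ≤ s) (hs : s ≤ 1 / 2) :
    |x| ^ (-s) ≤ cknW x := by
  have hx' : 0 < |x| := abs_pos.2 hx
  rcases le_total 1 |x| with h | h
  · exact (Real.rpow_le_one_of_one_le_of_nonpos h (by linarith)).trans (cknW_ge_one x)
  · have := Real.rpow_le_rpow_of_exponent_ge hx' h (by linarith : -(1 / 2 : ℝ) ≤ -s)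
    unfold cknW
    linarith

lemma cknDist_bound {d y γ : ℝ} (hγ : γ ∈ Set.Ico (1 / 3 : ℝ) (1 / 2))
    (hd : (1 + |y|) / 4 ≤ d) :
    d ^ (-(1 + 2 * γ)) ≤ 16 * (1 + |y|) ^ (-(5 / 3) : ℝ) := by
  obtain ⟨h1, h2⟩ := hγ
  have hy : 0 ≤ |y| := abs_nonneg y
  have e1 : d ^ (-(1 + 2 * γ)) ≤ ((1 + |y|) / 4) ^ (-(1 + 2 * γ)) :=
    Real.rpow_le_rpow_of_nonpos (by positivity) hd (by linarith)
  have e2 : ((1 + |y|) / 4) ^ (-(1 + 2 * γ)) =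
      (1 + |y|) ^ (-(1 + 2 * γ)) * (4 : ℝ) ^ (1 + 2 * γ) := by
    rw [Real.div_rpow (by positivity) (by norm_num), Real.rpow_neg (by norm_num : (0:ℝ) ≤ 4),
      div_inv_eq_mul]
  have e3 : (1 + |y|) ^ (-(1 + 2 * γ)) ≤ (1 + |y|) ^ (-(5 / 3) : ℝ) :=
    Real.rpow_le_rpow_of_exponent_le (by linarith) (by linarith)
  have e4 : (4 : ℝ) ^ (1 + 2 * γ) ≤ 16 := by
    calc (4 : ℝ) ^ (1 + 2 * γ) ≤ (4 : ℝ) ^ (2 : ℝ) :=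
          Real.rpow_le_rpow_of_exponent_le (by norm_num) (by linarith)
      _ = 16 := by norm_num
  calc d ^ (-(1 + 2 * γ)) ≤ (1 + |y|) ^ (-(1 + 2 * γ)) * (4 : ℝ) ^ (1 + 2 * γ) := e1.trans_eq e2
    _ ≤ (1 + |y|) ^ (-(5 / 3) : ℝ) * 16 := by gcongr
    _ = _ := by ring

structure CknBump (φ : ℝ → ℝ) (L : ℝ) : Prop where
  smooth : ContDiff ℝ (⊤ : ℕ∞) φ
  nonneg : ∀ x, 0 ≤ φ x
  le_one : ∀ x, φ x ≤ 1
  eq_one : ∀ x, |x| ≤ 1 → φ x = 1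
  eq_zero : ∀ x, 2 ≤ |x| → φ x = 0
  lip : ∀ x y, |φ x - φ y| ≤ L * |x - y|

lemma exists_cknBump : ∃ φ L, CknBump φ L := by
  let f : ContDiffBump (0 : ℝ) := ⟨1, 2, by norm_num, by norm_num⟩
  have hs : ContDiff ℝ (⊤ : ℕ∞) f := f.contDiff
  obtain ⟨L, hL⟩ := ContDiff.lipschitzWith_of_hasCompactSupport f.hasCompactSupport hs (by simp)
  refine ⟨f, L, hs, fun x => f.nonneg, fun x => f.le_one, fun x hx => ?_, fun x hx => ?_,
    fun x y => ?_⟩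
  · apply f.one_of_mem_closedBall
    simpa [f] using hx
  · apply f.zero_of_le_dist
    simpa [f] using hx
  · simpa [Real.dist_eq] using hL.dist_le_mul x y

section
variable {φ : ℝ → ℝ} {L : ℝ}

lemma cknTower_nonneg (hφ : CknBump φ L) (n : ℕ) (x : ℝ) : 0 ≤ cknTower φ n x := by
  induction n generalizing x with
  | zero => simp [cknTower]
  | succ n ih => exact add_nonneg (hφ.nonneg x) (ih _)

lemma cknTower_eq_zero (hφ : CknBump φ L) (n : ℕ) (x : ℝ) (hx : 2 ≤ |x|) :
    cknTower φ n x = 0 := by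
  induction n generalizing x with
  | zero => simp [cknTower]
  | succ n ih =>
    have : 2 ≤ |4 * x| := by rw [abs_mul]; norm_num; linarith
    simp [cknTower, hφ.eq_zero x hx, ih _ this]

lemma cknTower_smooth (hφ : CknBump φ L) (n : ℕ) : ContDiff ℝ (⊤ : ℕ∞) (cknTower φ n) := by
  induction n with
  | zero => exact contDiff_const
  | succ n ih => exact hφ.smooth.add (ih.comp (contDiff_const.mul contDiff_id))

lemma cknTower_eq (hφ : CknBump φ L) (n : ℕ) (x : ℝ) (hx : |x| ≤ (1 / 4) ^ n) :
    cknTower φ n x = n := by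
  induction n generalizing x with
  | zero => simp [cknTower]
  | succ n ih =>
    have h4 : |4 * x| ≤ (1 / 4) ^ n := by
      rw [abs_mul, abs_of_pos (by norm_num : (0:ℝ) < 4)]
      rw [pow_succ] at hx
      linarith
    have h1 : |x| ≤ 1 := hx.trans (pow_le_one₀ (by norm_num) (by norm_num))
    simp only [cknTower, hφ.eq_one x h1, ih _ h4]
    push_cast; ring

lemma cknTower_le (hφ : CknBump φ L) (n : ℕ) (x : ℝ) (hx : x ≠ 0) :
    cknTower φ n x ≤ 5 * |x| ^ (-(1 / 4) : ℝ) := by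
  induction n generalizing x with
  | zero => simp only [cknTower]; positivity
  | succ n ih =>
    have hx' : 0 < |x| := abs_pos.2 hx
    have h := ih (4 * x) (by simpa using hx)
    set t := |x| ^ (-(1 / 4) : ℝ) with ht
    have ht0 : 0 < t := by positivity
    have c1 : (4 : ℝ) ^ (-(1 / 4) : ℝ) ≤ 3 / 4 := by
      rw [Real.rpow_neg (by norm_num)]
      have : (4 / 3 : ℝ) ≤ (4 : ℝ) ^ (1 / 4 : ℝ) := by
        rw [one_div, Real.le_rpow_inv_iff_of_pos (by norm_num) (by norm_num) (by norm_num)]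
        norm_num
      rw [inv_le_comm₀ (by positivity) (by norm_num)]
      norm_num; norm_num at this; exact this
    have c2 : φ x ≤ 5 / 4 * t := by
      rcases le_total 2 |x| with h2 | h2
      · rw [hφ.eq_zero x h2]; positivity
      · have : (4 / 5 : ℝ) ≤ t := by
          have e : (2 : ℝ) ^ (-(1 / 4) : ℝ) ≤ t :=
            Real.rpow_le_rpow_of_nonpos hx' h2 (by norm_num)
          refine le_trans ?_ e
          rw [Real.rpow_neg (by norm_num), le_inv_comm₀ (by norm_num) (by positivity)]
          rw [one_div, Real.rpow_inv_le_iff_of_pos (by norm_num) (by norm_num) (by norm_num)]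
          norm_num
        linarith [hφ.le_one x]
    rw [abs_mul, abs_of_pos (by norm_num : (0:ℝ) < 4),
      Real.mul_rpow (by norm_num) hx'.le, ← ht] at h
    have : (4 : ℝ) ^ (-(1 / 4) : ℝ) * t ≤ 3 / 4 * t := by gcongr
    simp only [cknTower]
    linarith

lemma cknK_comm (γ α x y : ℝ) : cknK γ α x y = cknK γ α y x := by
  unfold cknK
  rw [abs_sub_comm]; ring

lemma cknK_nonneg (γ α x y : ℝ) : 0 ≤ cknK γ α x y := by
  unfold cknK; positivity

lemma cknPoint_aux (hφ : CknBump φ L) (n : ℕ) {γ α : ℝ} (hγ : γ ∈ Set.Ico (1 / 3 : ℝ) (1 / 2))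
    (hα : 0 < α) (hα' : α < 1 / 6) {x y : ℝ} (hx : x ≠ 0) (hy : y ≠ 0) (hxy : |x| ≤ |y|) :
    (cknTower φ (n + 1) x - cknTower φ (n + 1) y) ^ 2 * cknK γ α x y ≤
      (cknTower φ n (4 * x) - cknTower φ n (4 * y)) ^ 2 * cknK γ α x y +
      (16 * (L ^ 2 + 1) + 160) * (cknG x * cknH y) := by
  have hG := cknG_nonneg x
  have hH := cknH_nonneg y
  simp only [cknTower]
  by_cases ha : φ x = φ y
  · rw [ha]
    have : (φ y + cknTower φ n (4 * x) - (φ y + cknTower φ n (4 * y))) =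
      cknTower φ n (4 * x) - cknTower φ n (4 * y) := by ring
    rw [this]
    have : 0 ≤ (16 * (L ^ 2 + 1) + 160) * (cknG x * cknH y) := by positivity
    linarith
  have hx' : 0 < |x| := abs_pos.2 hx
  have hy' : 0 < |y| := abs_pos.2 hy
  have hx2 : |x| < 2 := by
    by_contra! h
    exact ha ((hφ.eq_zero x h).trans (hφ.eq_zero y (h.trans hxy)).symm)
  have hy1 : 1 ≤ |y| := by
    by_contra! h
    exact ha ((hφ.eq_one x (hxy.trans h.le)).trans (hφ.eq_one y h.le).symm)
  have hd : 0 < |x - y| := by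
    apply abs_pos.2
    intro h
    exact ha (by rw [sub_eq_zero.1 h])
  have htri : |y| ≤ |x| + |x - y| := by
    have := abs_sub_abs_le_abs_sub y x
    rw [abs_sub_comm y x] at this
    linarith
  have h4y : cknTower φ n (4 * y) = 0 := by
    apply cknTower_eq_zero hφ
    rw [abs_mul, abs_of_pos (by norm_num : (0:ℝ) < 4)]; linarith
  have hGx : cknG x = cknW x := by
    unfold cknG; rw [if_pos (by linarith)]
  set a := φ x - φ y with hadef
  set b := cknTower φ n (4 * x) with hb
  set d := |x - y| with hddef
  set J := (1 + |y|) ^ (-(5 / 3) : ℝ) with hJ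
  have hJ0 : 0 < J := by positivity
  have ha1 : |a| ≤ 1 := by
    rw [abs_le]
    constructor <;> linarith [hφ.nonneg x, hφ.nonneg y, hφ.le_one x, hφ.le_one y]
  have ha2 : a ^ 2 ≤ 1 := by rw [← sq_abs]; nlinarith [abs_nonneg a]
  have hb0 : 0 ≤ b := cknTower_nonneg hφ n _
  have hWx := cknW_bound hx hα.le (by linarith)
  have hWy := cknW_bound hy hα.le (by linarith)
  have hW1 := cknW_ge_one x
  have hW2 := cknW_ge_one y
  have hD0 : 0 ≤ d ^ (-(1 + 2 * γ)) := by positivity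
  -- first term
  have T1 : a ^ 2 * d ^ (-(1 + 2 * γ)) ≤ 16 * (L ^ 2 + 1) * J := by
    rcases le_total 1 d with h1 | h1
    · have := cknDist_bound (d := d) (y := y) hγ (by linarith)
      calc a ^ 2 * d ^ (-(1 + 2 * γ)) ≤ 1 * (16 * J) := by gcongr
        _ ≤ _ := by nlinarith [sq_nonneg L]
    · have hl : a ^ 2 ≤ L ^ 2 * d ^ 2 := by
        rw [← sq_abs a, ← mul_pow]
        exact pow_le_pow_left₀ (abs_nonneg _) (hφ.lip x y) 2
      have hdd : d ^ 2 * d ^ (-(1 + 2 * γ)) ≤ 1 := by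
        rw [← Real.rpow_natCast, ← Real.rpow_add hd]
        exact Real.rpow_le_one hd.le h1 (by push_cast; linarith [hγ.2])
      have hJ1 : 1 ≤ 16 * J := by
        have e : (4 : ℝ) ^ (-(5 / 3) : ℝ) ≤ J :=
          Real.rpow_le_rpow_of_nonpos (by positivity) (by linarith) (by norm_num)
        have e' : (4 : ℝ) ^ (-2 : ℝ) ≤ (4 : ℝ) ^ (-(5 / 3) : ℝ) :=
          Real.rpow_le_rpow_of_exponent_le (by norm_num) (by norm_num)
        have e'' : (4 : ℝ) ^ (-2 : ℝ) = 1 / 16 := by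
          rw [Real.rpow_neg (by norm_num)]; norm_num
        linarith
      calc a ^ 2 * d ^ (-(1 + 2 * γ)) ≤ L ^ 2 * d ^ 2 * d ^ (-(1 + 2 * γ)) := by gcongr
        _ = L ^ 2 * (d ^ 2 * d ^ (-(1 + 2 * γ))) := by ring
        _ ≤ L ^ 2 * 1 := by gcongr
        _ ≤ (L ^ 2 + 1) * 1 := by linarith
        _ ≤ (L ^ 2 + 1) * (16 * J) := by gcongr
        _ = _ := by ring
  have T2 : b * d ^ (-(1 + 2 * γ)) * |x| ^ (-α) ≤ 80 * J * cknW x := by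
    rcases le_total |x| (1 / 2) with h | h
    · have e1 := cknDist_bound (d := d) (y := y) hγ (by linarith)
      have e2 : b ≤ 5 * |x| ^ (-(1 / 4) : ℝ) := by
        refine (cknTower_le hφ n (4 * x) (by simpa using hx)).trans ?_
        have : |4 * x| ^ (-(1 / 4) : ℝ) ≤ |x| ^ (-(1 / 4) : ℝ) := by
          apply Real.rpow_le_rpow_of_nonpos hx' _ (by norm_num)
          rw [abs_mul, abs_of_pos (by norm_num : (0:ℝ) < 4)]; linarith
        linarith
      have e3 : |x| ^ (-(1 / 4) : ℝ) * |x| ^ (-α) ≤ cknW x := by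
        rw [← Real.rpow_add hx', ← neg_add]
        exact cknW_bound hx (by linarith) (by linarith)
      calc b * d ^ (-(1 + 2 * γ)) * |x| ^ (-α)
          ≤ (5 * |x| ^ (-(1 / 4) : ℝ)) * (16 * J) * |x| ^ (-α) := by gcongr
        _ = 80 * J * (|x| ^ (-(1 / 4) : ℝ) * |x| ^ (-α)) := by ring
        _ ≤ _ := by gcongr
    · have : b = 0 := by
        apply cknTower_eq_zero hφ
        rw [abs_mul, abs_of_pos (by norm_num : (0:ℝ) < 4)]; linarith
      rw [this]
      simp only [zero_mul]
      positivity
  have hab : a * b ≤ b := by nlinarith [le_abs_self a]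
  rw [hGx, h4y]
  have hHy : cknH y = cknW y * J := rfl
  rw [hHy]
  unfold cknK
  rw [← hddef]
  set D := d ^ (-(1 + 2 * γ))
  set X := |x| ^ (-α)
  set Y := |y| ^ (-α)
  have hX0 : 0 ≤ X := by positivity
  have hY0 : 0 ≤ Y := by positivity
  have F1 : a ^ 2 * D * (X * Y) ≤ 16 * (L ^ 2 + 1) * J * (cknW x * cknW y) := by gcongr
  have F2 : b * D * X * Y ≤ 80 * J * cknW x * cknW y := by gcongr
  have F3 : a * b * (D * (X * Y)) ≤ b * (D * (X * Y)) := by gcongr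
  have : φ x + b - (φ y + 0) = a + b := by rw [hadef]; ring
  rw [this]
  nlinarith

lemma cknPoint (hφ : CknBump φ L) (n : ℕ) {γ α : ℝ} (hγ : γ ∈ Set.Ico (1 / 3 : ℝ) (1 / 2))
    (hα : 0 < α) (hα' : α < 1 / 6) {x y : ℝ} (hx : x ≠ 0) (hy : y ≠ 0) :
    (cknTower φ (n + 1) x - cknTower φ (n + 1) y) ^ 2 * cknK γ α x y ≤
      (cknTower φ n (4 * x) - cknTower φ n (4 * y)) ^ 2 * cknK γ α x y +
      (16 * (L ^ 2 + 1) + 160) * (cknG x * cknH y + cknH x * cknG y) := by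
  have hA : 0 ≤ 16 * (L ^ 2 + 1) + 160 := by positivity
  have n1 := mul_nonneg hA (mul_nonneg (cknG_nonneg x) (cknH_nonneg y))
  have n2 := mul_nonneg hA (mul_nonneg (cknG_nonneg y) (cknH_nonneg x))
  rcases le_total |x| |y| with h | h
  · have := cknPoint_aux hφ n hγ hα hα' hx hy h
    linarith
  · have := cknPoint_aux hφ n hγ hα hα' hy hx h
    rw [cknK_comm γ α y x] at this
    have s1 : ∀ s t : ℝ, (s - t) ^ 2 = (t - s) ^ 2 := fun s t => by ring
    rw [s1 (cknTower φ (n + 1) y), s1 (cknTower φ n (4 * y))] at this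
    linarith

end

lemma cknW_measurable : Measurable cknW := by
  unfold cknW; fun_prop

lemma cknG_measurable : Measurable cknG := by
  unfold cknG
  exact Measurable.ite (measurableSet_le measurable_norm measurable_const)
    cknW_measurable measurable_const

lemma cknH_measurable : Measurable cknH := by
  unfold cknH
  have := cknW_measurable
  fun_prop

lemma cknG_integrable : Integrable cknG := by
  have h0 : IntervalIntegrable (fun x : ℝ => |x| ^ (-(1 / 2) : ℝ)) volume 0 3 := by
    have := intervalIntegral.intervalIntegrable_rpow' (a := 0) (b := 3)
      (by norm_num : (-1 : ℝ) < -(1 / 2))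
    refine this.congr ?_
    intro x hx
    rw [Set.uIoc_of_le (by norm_num)] at hx
    simp only [abs_of_pos hx.1]
  have h1 : IntervalIntegrable (fun x : ℝ => |x| ^ (-(1 / 2) : ℝ)) volume (-3) 0 := by
    rw [IntervalIntegrable.iff_comp_neg]
    simp only [abs_neg, neg_neg, neg_zero]
    exact h0.symm
  have h2 := h1.trans h0
  rw [intervalIntegrable_iff_integrableOn_Icc_of_le (by norm_num)] at h2
  have h3 : IntegrableOn cknW (Set.Icc (-3) 3) := by
    have hc : IntegrableOn (fun _ : ℝ => (1 : ℝ)) (Set.Icc (-3) 3) := by simp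
    exact hc.add h2
  have : cknG = (Set.Icc (-3 : ℝ) 3).indicator cknW := by
    ext x
    unfold cknG
    simp only [Set.indicator_apply, Set.mem_Icc, abs_le]
  rw [this, integrable_indicator_iff measurableSet_Icc]
  exact h3

lemma cknH_integrable : Integrable cknH := by
  have h1 : Integrable (fun x : ℝ => (1 + ‖x‖) ^ (-(5 / 3) : ℝ)) :=
    integrable_one_add_norm (by norm_num)
  refine (cknG_integrable.add (h1.const_mul 2)).mono' cknH_measurable.aestronglyMeasurable ?_
  filter_upwards with x
  rw [Real.norm_of_nonneg (cknH_nonneg x)]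
  simp only [Pi.add_apply, Real.norm_eq_abs]
  have hx := abs_nonneg x
  have hJ : 0 ≤ (1 + |x|) ^ (-(5 / 3) : ℝ) := by positivity
  have hJ1 : (1 + |x|) ^ (-(5 / 3) : ℝ) ≤ 1 :=
    Real.rpow_le_one_of_one_le_of_nonpos (by linarith) (by norm_num)
  have hW := cknW_ge_one x
  rcases le_total |x| 3 with h | h
  · have : cknG x = cknW x := by unfold cknG; rw [if_pos h]
    rw [this]
    unfold cknH
    nlinarith
  · have h2 : cknW x ≤ 2 := by
      have := Real.rpow_le_one_of_one_le_of_nonpos (by linarith : 1 ≤ |x|)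
        (by norm_num : (-(1 / 2) : ℝ) ≤ 0)
      unfold cknW; linarith
    have := cknG_nonneg x
    unfold cknH
    nlinarith

lemma ckn_lintegral_scale (f : ℝ → ℝ≥0∞) :
    ∫⁻ x : ℝ, f (4 * x) = ENNReal.ofReal (1 / 4) * ∫⁻ x, f x := by
  have h := lintegral_map_equiv (μ := (volume : Measure ℝ)) f
    (Homeomorph.mulLeft₀ (4 : ℝ) (by norm_num)).toMeasurableEquiv
  have e : Measure.map (Homeomorph.mulLeft₀ (4 : ℝ) (by norm_num)).toMeasurableEquiv
      (volume : Measure ℝ) = ENNReal.ofReal |(4 : ℝ)⁻¹| • volume :=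
    Real.map_volume_mul_left (by norm_num)
  rw [e, lintegral_smul_measure] at h
  simp only [smul_eq_mul] at h
  have e2 : |(4 : ℝ)⁻¹| = 1 / 4 := by rw [abs_of_pos] <;> norm_num
  rw [e2] at h
  exact h.symm

lemma cknK_scale (γ α x y : ℝ) :
    cknK γ α x y = 4 ^ (1 + 2 * γ + 2 * α) * cknK γ α (4 * x) (4 * y) := by
  unfold cknK
  have h4 : (0 : ℝ) < 4 := by norm_num
  rw [← mul_sub, abs_mul, abs_mul, abs_mul, abs_of_pos h4,
    Real.mul_rpow h4.le (abs_nonneg _), Real.mul_rpow h4.le (abs_nonneg _),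
    Real.mul_rpow h4.le (abs_nonneg _)]
  have : (4 : ℝ) ^ (1 + 2 * γ + 2 * α) * (4 ^ (-(1 + 2 * γ)) * (4 ^ (-α) * 4 ^ (-α))) = 1 := by
    rw [← Real.rpow_add h4, ← Real.rpow_add h4, ← Real.rpow_add h4]
    ring_nf
    exact Real.rpow_zero _
  linear_combination (-(|x - y| ^ (-(1 + 2 * γ)) * (|x| ^ (-α) * |y| ^ (-α)))) * this

lemma ckn_energy_scale (u : ℝ → ℝ) {γ α : ℝ} (hα' : α < (1 - 2 * γ) / 2) :
    ∫⁻ x : ℝ, ∫⁻ y : ℝ, ENNReal.ofReal ((u (4 * x) - u (4 * y)) ^ 2 * cknK γ α x y) ≤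
      cknEnergy γ α u := by
  have h4 : (0 : ℝ) < 4 := by norm_num
  set c : ℝ := 4 ^ (1 + 2 * γ + 2 * α) with hc
  have hc0 : 0 ≤ c := by positivity
  have hc1 : c ≤ 16 := by
    calc c ≤ (4 : ℝ) ^ (2 : ℝ) :=
          Real.rpow_le_rpow_of_exponent_le (by norm_num) (by linarith)
      _ = 16 := by norm_num
  have e : ∀ x y : ℝ, ENNReal.ofReal ((u (4 * x) - u (4 * y)) ^ 2 * cknK γ α x y) =
      ENNReal.ofReal c *
        ENNReal.ofReal ((u (4 * x) - u (4 * y)) ^ 2 * cknK γ α (4 * x) (4 * y)) := by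
    intro x y
    rw [← ENNReal.ofReal_mul hc0, cknK_scale γ α x y]
    congr 1; ring
  simp_rw [e]
  have e1 : ∀ x : ℝ, ∫⁻ y : ℝ, ENNReal.ofReal c *
        ENNReal.ofReal ((u (4 * x) - u (4 * y)) ^ 2 * cknK γ α (4 * x) (4 * y)) =
      ENNReal.ofReal c * (ENNReal.ofReal (1 / 4) *
        ∫⁻ y : ℝ, ENNReal.ofReal ((u (4 * x) - u y) ^ 2 * cknK γ α (4 * x) y)) := by
    intro x
    rw [lintegral_const_mul' _ _ ENNReal.ofReal_ne_top,
      ckn_lintegral_scale (fun y => ENNReal.ofReal ((u (4 * x) - u y) ^ 2 * cknK γ α (4 * x) y))]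
  simp_rw [e1]
  rw [lintegral_const_mul' _ _ ENNReal.ofReal_ne_top,
    lintegral_const_mul' _ _ ENNReal.ofReal_ne_top,
    ckn_lintegral_scale
      (fun x => ∫⁻ y : ℝ, ENNReal.ofReal ((u x - u y) ^ 2 * cknK γ α x y))]
  rw [← mul_assoc, ← mul_assoc, ← ENNReal.ofReal_mul hc0, ← ENNReal.ofReal_mul (by positivity)]
  calc _ ≤ 1 * cknEnergy γ α u := by
        unfold cknEnergy
        gcongr
        rw [ENNReal.ofReal_le_one]
        linarith
    _ = _ := one_mul _

/-- Uniform energy increment. -/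
noncomputable def cknD (L : ℝ) : ℝ≥0∞ :=
  ENNReal.ofReal (16 * (L ^ 2 + 1) + 160) *
    ((∫⁻ x, ENNReal.ofReal (cknG x)) * (∫⁻ x, ENNReal.ofReal (cknH x)) +
      (∫⁻ x, ENNReal.ofReal (cknH x)) * (∫⁻ x, ENNReal.ofReal (cknG x)))

lemma cknD_ne_top (L : ℝ) : cknD L ≠ ⊤ := by
  have h1 : (∫⁻ x, ENNReal.ofReal (cknG x)) ≠ ⊤ := cknG_integrable.lintegral_lt_top.ne
  have h2 : (∫⁻ x, ENNReal.ofReal (cknH x)) ≠ ⊤ := cknH_integrable.lintegral_lt_top.ne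
  unfold cknD
  finiteness

lemma cknTower_energy {φ : ℝ → ℝ} {L : ℝ} (hφ : CknBump φ L) (n : ℕ) {γ α : ℝ}
    (hγ : γ ∈ Set.Ico (1 / 3 : ℝ) (1 / 2)) (hα : 0 < α) (hα' : α < (1 - 2 * γ) / 2) :
    cknEnergy γ α (cknTower φ n) ≤ n * cknD L := by
  induction n with
  | zero => simp [cknEnergy, cknTower]
  | succ n ih =>
    have hα6 : α < 1 / 6 := by linarith [hγ.1]
    set A : ℝ := 16 * (L ^ 2 + 1) + 160 with hA
    have hA0 : 0 ≤ A := by positivity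
    have hGm : Measurable (fun x => ENNReal.ofReal (cknG x)) := cknG_measurable.ennreal_ofReal
    have hHm : Measurable (fun x => ENNReal.ofReal (cknH x)) := cknH_measurable.ennreal_ofReal
    have hne : ∀ᵐ x : ℝ, x ≠ 0 := by
      simp [ae_iff]
    have step1 : cknEnergy γ α (cknTower φ (n + 1)) ≤
        ∫⁻ x : ℝ, ((∫⁻ y : ℝ, ENNReal.ofReal
          ((cknTower φ n (4 * x) - cknTower φ n (4 * y)) ^ 2 * cknK γ α x y)) +
          ENNReal.ofReal A * (ENNReal.ofReal (cknG x) * (∫⁻ y, ENNReal.ofReal (cknH y)) +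
            ENNReal.ofReal (cknH x) * (∫⁻ y, ENNReal.ofReal (cknG y)))) := by
      unfold cknEnergy
      apply lintegral_mono_ae
      filter_upwards [hne] with x hx
      have : (ENNReal.ofReal A * (ENNReal.ofReal (cknG x) * (∫⁻ y, ENNReal.ofReal (cknH y)) +
            ENNReal.ofReal (cknH x) * (∫⁻ y, ENNReal.ofReal (cknG y)))) =
          ∫⁻ y, ENNReal.ofReal A * (ENNReal.ofReal (cknG x) * ENNReal.ofReal (cknH y) +
            ENNReal.ofReal (cknH x) * ENNReal.ofReal (cknG y)) := by
        rw [lintegral_const_mul' _ _ ENNReal.ofReal_ne_top,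
          lintegral_add_right _ (hGm.const_mul _),
          lintegral_const_mul' _ _ ENNReal.ofReal_ne_top,
          lintegral_const_mul' _ _ ENNReal.ofReal_ne_top]
      rw [this, ← lintegral_add_right _ (by fun_prop)]
      apply lintegral_mono_ae
      filter_upwards [hne] with y hy
      have hp := cknPoint hφ n hγ hα hα6 hx hy
      refine (ENNReal.ofReal_le_ofReal hp).trans ?_
      refine ENNReal.ofReal_add_le.trans ?_
      gcongr
      rw [ENNReal.ofReal_mul hA0,
        ENNReal.ofReal_add (mul_nonneg (cknG_nonneg x) (cknH_nonneg y))
          (mul_nonneg (cknH_nonneg x) (cknG_nonneg y)),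
        ENNReal.ofReal_mul (cknG_nonneg x), ENNReal.ofReal_mul (cknH_nonneg x)]
    have step2 : ∫⁻ x, ENNReal.ofReal A *
          (ENNReal.ofReal (cknG x) * (∫⁻ y, ENNReal.ofReal (cknH y)) +
            ENNReal.ofReal (cknH x) * (∫⁻ y, ENNReal.ofReal (cknG y))) = cknD L := by
      rw [lintegral_const_mul' _ _ ENNReal.ofReal_ne_top,
          lintegral_add_right _ (hHm.mul_const _),
          lintegral_mul_const _ hGm, lintegral_mul_const _ hHm]
      rfl
    rw [lintegral_add_right _ (by fun_prop), step2] at step1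
    calc _ ≤ _ := step1
      _ ≤ cknEnergy γ α (cknTower φ n) + cknD L := by
          gcongr
          exact ckn_energy_scale _ hα'
      _ ≤ n * cknD L + cknD L := by gcongr
      _ = _ := by push_cast; ring

lemma cknTower_mass {φ : ℝ → ℝ} {L : ℝ} (hφ : CknBump φ L) (n : ℕ) {β p : ℝ}
    (hp : 0 < p) (hβ : 0 < β) :
    ENNReal.ofReal ((n : ℝ) ^ p * (1 / 4) ^ n) ≤ cknMass β p (cknTower φ n) := by
  have hr : (0 : ℝ) < (1 / 4) ^ n := by positivity
  have hr1 : ((1 : ℝ) / 4) ^ n ≤ 1 := pow_le_one₀ (by norm_num) (by norm_num)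
  calc ENNReal.ofReal ((n : ℝ) ^ p * (1 / 4) ^ n)
      = ∫⁻ x in Set.Ioc (0 : ℝ) ((1 / 4) ^ n), ENNReal.ofReal ((n : ℝ) ^ p) := by
        rw [setLIntegral_const, Real.volume_Ioc, sub_zero, ENNReal.ofReal_mul (by positivity)]
    _ ≤ ∫⁻ x in Set.Ioc (0 : ℝ) ((1 / 4) ^ n),
          ENNReal.ofReal (|cknTower φ n x| ^ p * |x| ^ (-(β * p))) := by
        apply setLIntegral_mono' measurableSet_Ioc
        intro x hx
        apply ENNReal.ofReal_le_ofReal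
        have hx1 : |x| = x := abs_of_pos hx.1
        rw [cknTower_eq hφ n x (by rw [hx1]; exact hx.2), hx1, abs_of_nonneg (Nat.cast_nonneg n)]
        have : 1 ≤ x ^ (-(β * p)) :=
          Real.one_le_rpow_of_pos_of_le_one_of_nonpos hx.1 (hx.2.trans hr1)
            (by have := mul_pos hβ hp; linarith)
        exact le_mul_of_one_le_right (by positivity) this
    _ ≤ _ := setLIntegral_le_lintegral _ _

lemma ckn_S_bound {φ : ℝ → ℝ} {L : ℝ} (hφ : CknBump φ L) {γ α β p : ℝ}
    (hγ : γ ∈ Set.Ico (1 / 3 : ℝ) (1 / 2)) (hα : 0 < α) (hα' : α < (1 - 2 * γ) / 2)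
    (hαβ : α < β) (hp : 4 ≤ p) :
    cknS γ α β p ≤ (32 * (cknD L).toReal + 2) / p := by
  set N := ⌊p⌋₊ with hN
  have hNp : (N : ℝ) ≤ p := Nat.floor_le (by linarith)
  have hpN : p < N + 1 := Nat.lt_floor_add_one p
  have hN3 : (3 : ℝ) < N := by linarith
  have hD0 : 0 ≤ (cknD L).toReal := ENNReal.toReal_nonneg
  set U := cknTower φ N with hU
  have hbdd : BddBelow {q : ℝ | ∃ u : ℝ → ℝ, ContDiff ℝ (⊤ : ℕ∞) u ∧ HasCompactSupport u ∧
      u ≠ 0 ∧ q = cknQuot γ α β p u} := by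
    refine ⟨0, ?_⟩
    rintro q ⟨u, -, -, -, rfl⟩
    unfold cknQuot; positivity
  have hmem : cknQuot γ α β p U ∈ {q : ℝ | ∃ u : ℝ → ℝ, ContDiff ℝ (⊤ : ℕ∞) u ∧
      HasCompactSupport u ∧ u ≠ 0 ∧ q = cknQuot γ α β p u} := by
    refine ⟨U, cknTower_smooth hφ N, ?_, ?_, rfl⟩
    · apply HasCompactSupport.intro (isCompact_Icc (a := (-2 : ℝ)) (b := 2))
      intro x hx
      apply cknTower_eq_zero hφ
      by_contra! h
      exact hx (abs_le.1 h.le)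
    · intro h
      have h0 := congrFun h 0
      rw [hU, cknTower_eq hφ N 0 (by simp)] at h0
      simp only [Pi.zero_apply] at h0
      linarith
  refine (csInf_le hbdd hmem).trans ?_
  unfold cknQuot
  have hE : (cknEnergy γ α U).toReal ≤ N * (cknD L).toReal := by
    have := ENNReal.toReal_mono (ENNReal.mul_ne_top (ENNReal.natCast_ne_top N) (cknD_ne_top L))
      (cknTower_energy hφ N hγ hα hα')
    simpa using this
  by_cases hM : cknMass β p U = ⊤
  · rw [hM, ENNReal.toReal_top, Real.zero_rpow (by positivity), div_zero]
    positivity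
  have hM1 : (N : ℝ) ^ p * (1 / 4) ^ N ≤ (cknMass β p U).toReal := by
    rw [← ENNReal.ofReal_le_iff_le_toReal hM]
    exact cknTower_mass hφ N (by linarith) (by linarith)
  have hM2 : (N : ℝ) ^ 2 / 16 ≤ (cknMass β p U).toReal ^ (2 / p) := by
    have hp0 : 0 < p := by linarith
    have hN0 : (0 : ℝ) ≤ N := by linarith
    refine le_trans ?_ (Real.rpow_le_rpow (by positivity) hM1 (by positivity))
    rw [Real.mul_rpow (by positivity) (by positivity), ← Real.rpow_mul hN0,
      mul_div_cancel₀ _ hp0.ne', ← Real.rpow_natCast (1 / 4 : ℝ) N,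
      ← Real.rpow_mul (by norm_num), Real.rpow_two]
    have : (1 / 16 : ℝ) ≤ (1 / 4 : ℝ) ^ ((N : ℝ) * (2 / p)) := by
      have e : (1 / 4 : ℝ) ^ (2 : ℝ) ≤ (1 / 4 : ℝ) ^ ((N : ℝ) * (2 / p)) := by
        apply Real.rpow_le_rpow_of_exponent_ge (by norm_num) (by norm_num)
        rw [← mul_div_assoc, div_le_iff₀ hp0]; linarith
      norm_num at e ⊢
      exact e
    rw [div_eq_mul_one_div]
    gcongr
  have hpos : (0 : ℝ) < (N : ℝ) ^ 2 / 16 := by positivity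
  calc (cknEnergy γ α U).toReal / (cknMass β p U).toReal ^ (2 / p)
      ≤ (N * (cknD L).toReal) / ((N : ℝ) ^ 2 / 16) := by gcongr
    _ = 16 * (cknD L).toReal / N := by
        field_simp
    _ ≤ _ := by
        rw [div_le_div_iff₀ (by linarith) (by linarith)]
        nlinarith

/-- Uniform bound on the best fractional CKN constant in dimension one: `S_γ(α,β) ≤ C/p`
for large `p` with `βp ≤ bbar`, and any nonnegative extremal satisfying the energy identity
has uniformly bounded weighted mass. -/
theorem stmt_3 (bbar : ℝ) (hbbar : bbar ∈ Set.Ioo (0 : ℝ) 1) :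
    ∃ C : ℝ, 0 < C ∧ ∃ p₀ : ℝ, 4 ≤ p₀ ∧
      ∀ γ α β : ℝ, γ ∈ Set.Ico (1 / 3 : ℝ) (1 / 2) → 0 < α → α < (1 - 2 * γ) / 2 →
        α < β → β < α + γ →
        ∀ p : ℝ, p = 2 / (1 - 2 * γ + 2 * (β - α)) → p₀ ≤ p → β * p ≤ bbar →
          cknS γ α β p ≤ C / p ∧
          ∀ u : ℝ → ℝ, Measurable u → (∀ x, 0 ≤ u x) →
            cknEnergy γ α u ≠ ⊤ → cknMass β p u ≠ 0 → cknMass β p u ≠ ⊤ →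
            cknQuot γ α β p u = cknS γ α β p →
            (1 / 2) * (cknEnergy γ α u).toReal = (1 / p) * (cknMass β p u).toReal →
            (cknMass β p u).toReal ≤ C := by
  obtain ⟨φ, L, hφ⟩ := exists_cknBump
  set C1 : ℝ := 32 * (cknD L).toReal + 2 with hC1
  have hC2 : 2 ≤ C1 := by
    have : 0 ≤ (cknD L).toReal := ENNReal.toReal_nonneg
    linarith
  refine ⟨C1 ^ 2, by positivity, 4, le_rfl, ?_⟩
  intro γ α β hγ hα hα' hαβ _ p _ hp _
  have hp0 : 0 < p := by linarith
  have hS : cknS γ α β p ≤ C1 / p := ckn_S_bound hφ hγ hα hα' hαβ hp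
  constructor
  · refine hS.trans ?_
    gcongr
    nlinarith
  intro u _ _ _ hM0 hMt hq hid
  rw [← hq] at hS
  unfold cknQuot at hS
  set M := (cknMass β p u).toReal with hM
  have hMpos : 0 < M := ENNReal.toReal_pos hM0 hMt
  have hE : (cknEnergy γ α u).toReal = 2 * M / p := by
    field_simp
    field_simp at hid
    linarith
  rw [hE, div_le_div_iff₀ (by positivity) hp0, div_mul_cancel₀ _ hp0.ne'] at hS
  by_cases h1 : M ≤ 1
  · nlinarith
  push Not at h1
  have h2 : M ^ (2 / p) ≤ M ^ (1 / 2 : ℝ) := by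
    apply Real.rpow_le_rpow_of_exponent_le h1.le
    rw [div_le_iff₀ hp0]; linarith
  set R := M ^ (1 / 2 : ℝ) with hR
  have hR0 : 0 < R := by positivity
  have hRM : R * R = M := by
    rw [hR, ← Real.rpow_add hMpos]; norm_num
  have h3 : 2 * M ≤ C1 * R := hS.trans (by gcongr)
  have h4 : R ≤ C1 := by
    rw [← hRM] at h3
    by_contra! h
    nlinarith
  rw [← hRM]
  nlinarith
end

section
/- Let b ∈ (−1,0), set η(x) = log( 2(1−b) cos(πb/2) / ( |x|^{2(1−b)} + 2|x|^{1−b} sin(πb/2) + 1 ) ) and κ = 2π(1−b). Then the Onofri-type inequality fails for this b: there exists a compactly supported Lipschitz function v : ℝ → ℝ with ∫_ℝ∫_ℝ (v(x)−v(y))²/(x−y)² dx dy < ∞ such that log( (1/κ) ∫_ℝ e^{v(x)} e^{η(x)} |x|^{−b} dx ) > (1/(4πκ)) ∫_ℝ∫_ℝ (v(x)−v(y))²/(x−y)² dx dy + (1/κ) ∫_ℝ v(x) e^{η(x)} |x|^{−b} dx. -/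
open MeasureTheory Real

lemma lintegral_pm (h : ℝ → ENNReal) (hm : Measurable h) :
    ∫⁻ x, h x = ∫⁻ s : ℝ, ENNReal.ofReal (exp s) * (h (exp s) + h (-exp s)) := by
  have key : ∀ f : ℝ → ENNReal, ∫⁻ x in Set.Ioi (0:ℝ), f x = ∫⁻ s : ℝ, ENNReal.ofReal (exp s) * f (exp s) := by
    intro f
    have := lintegral_image_eq_lintegral_abs_deriv_mul (s := Set.univ) (f := Real.exp) (f' := Real.exp)
      MeasurableSet.univ (fun x _ => (Real.hasDerivAt_exp x).hasDerivWithinAt) (Real.exp_injective.injOn) f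
    rw [Set.image_univ, Real.range_exp] at this
    simpa [abs_of_pos (Real.exp_pos _)] using this
  have h1 : ∫⁻ x in Set.Iic (0:ℝ), h x = ∫⁻ x in Set.Ioi (0:ℝ), h (-x) := by
    rw [setLIntegral_congr (Iio_ae_eq_Iic (a := (0:ℝ))).symm]
    have := (Measure.measurePreserving_neg (volume : Measure ℝ)).setLIntegral_comp_preimage
      (s := Set.Iio (0:ℝ)) measurableSet_Iio hm
    rw [← this]
    simp
  rw [← lintegral_add_compl h (measurableSet_Ioi (a := (0:ℝ))), Set.compl_Ioi, h1, key h, key (fun x => h (-x)),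
    ← lintegral_add_left (by fun_prop)]
  simp only [mul_add]

/-- kernel -/
noncomputable def Kr (r : ℝ) : ℝ := exp r * (1 / (1 - exp r) ^ 2 + 1 / (1 + exp r) ^ 2)

lemma Kr_nonneg (r : ℝ) : 0 ≤ Kr r := by unfold Kr; positivity

lemma Kr_neg (r : ℝ) : Kr (-r) = Kr r := by
  unfold Kr
  rw [exp_neg]
  have h := exp_pos r
  by_cases h1 : exp r = 1
  · simp [h1]
  have h2 : 1 - exp r ≠ 0 := fun h => h1 (by linarith)
  have h3 : exp r - 1 ≠ 0 := fun h => h1 (by linarith)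
  have h4 : 1 - (exp r)⁻¹ ≠ 0 := by
    intro h5; apply h1; field_simp at h5; linarith
  have e1 : 1 - (exp r)⁻¹ = -(1 - exp r) / exp r := by field_simp; ring
  have e2 : 1 + (exp r)⁻¹ = (1 + exp r) / exp r := by field_simp; ring
  rw [e1, e2]
  field_simp

lemma Kr_series (r : ℝ) (hr : 0 < r) :
    HasSum (fun k : ℕ => 2 * (2 * (k:ℝ) + 1) * exp (-((2 * k + 1) * r))) (Kr r) := by
  rw [← Kr_neg]
  set t := exp (-r) with ht
  have ht0 : 0 < t := exp_pos _
  have ht1 : t < 1 := by rw [ht, exp_lt_one_iff]; linarith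
  have hq : ‖t ^ 2‖ < 1 := by
    rw [norm_of_nonneg (by positivity)]; nlinarith
  have h1 := hasSum_coe_mul_geometric_of_norm_lt_one hq
  have h2 := hasSum_geometric_of_norm_lt_one hq
  have h3 := ((h1.mul_left 2).add h2).mul_left (2 * t)
  have h5 : 1 - t ≠ 0 := by linarith
  have h6 : 1 - t ^ 2 ≠ 0 := by nlinarith
  have h7 : 1 + t ≠ 0 := by linarith
  have ef : (fun k : ℕ => 2 * (2 * (k:ℝ) + 1) * exp (-((2 * k + 1) * r))) =
      fun i : ℕ => 2 * t * (2 * ((i:ℝ) * (t ^ 2) ^ i) + (t ^ 2) ^ i) := by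
    ext k
    have : exp (-((2 * k + 1) * r)) = t * (t ^ 2) ^ k := by
      rw [ht, ← exp_nat_mul, ← exp_nat_mul, ← exp_add]; congr 1; push_cast; ring
    rw [this]; ring
  have ev : Kr (-r) = 2 * t * (2 * (t ^ 2 / (1 - t ^ 2) ^ 2) + (1 - t ^ 2)⁻¹) := by
    unfold Kr
    rw [← ht]
    have : 1 - t ^ 2 = (1 - t) * (1 + t) := by ring
    rw [this]; field_simp; ring
  rw [ef, ev]; exact h3

lemma odd_sq_sum : HasSum (fun k : ℕ => 1 / (2 * (k:ℝ) + 1) ^ 2) (π ^ 2 / 8) := by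
  have h := hasSum_zeta_two
  have he : HasSum (fun k : ℕ => 1 / ((2 * k : ℕ) : ℝ) ^ 2) (π ^ 2 / 24) := by
    have h4 := h.mul_left (1/4)
    have ef : (fun k : ℕ => 1 / ((2 * k : ℕ) : ℝ) ^ 2) = fun k : ℕ => 1 / 4 * (1 / (k:ℝ) ^ 2) := by
      ext k; push_cast; rw [mul_pow]; ring
    have ev : π ^ 2 / 24 = 1 / 4 * (π ^ 2 / 6) := by ring
    rw [ef, ev]; exact h4
  have hs : Summable (fun k : ℕ => 1 / ((2 * k + 1 : ℕ) : ℝ) ^ 2) :=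
    h.summable.comp_injective (i := fun k : ℕ => 2 * k + 1) (fun a b hab => by simpa using hab)
  have ho := he.even_add_odd (f := fun n : ℕ => 1 / (n:ℝ) ^ 2) hs.hasSum
  have := ho.unique h
  have h2 : (∑' k : ℕ, 1 / ((2 * k + 1 : ℕ) : ℝ) ^ 2) = π ^ 2 / 8 := by linarith
  have h3 := hs.hasSum
  rw [h2] at h3
  simpa using h3

lemma gamma_int (m : ℝ) (hm : 0 < m) :
    ∫⁻ r in Set.Ioi (0:ℝ), ENNReal.ofReal (r ^ 2 * exp (-(m * r))) = ENNReal.ofReal (2 / m ^ 3) := by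
  have h := Real.integral_rpow_mul_exp_neg_mul_Ioi (a := 3) (r := m) (by norm_num) hm
  have hG : Real.Gamma 3 = 2 := by
    have := Real.Gamma_nat_eq_factorial 2
    rw [show (3:ℝ) = ((2:ℕ):ℝ) + 1 by norm_num, this]; norm_num [Nat.factorial]
  have hi : IntegrableOn (fun r : ℝ => r ^ 2 * exp (-(m * r))) (Set.Ioi 0) := by
    by_contra hc
    have h0 : (∫ t in Set.Ioi (0:ℝ), t ^ ((3:ℝ) - 1) * exp (-(m * t))) = 0 := by
      have : ∀ t : ℝ, t ^ ((3:ℝ) - 1) = t ^ 2 := by intro t; norm_num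
      simp_rw [this]
      exact integral_undef hc
    rw [h0, hG] at h
    have : (0:ℝ) < (1 / m) ^ (3:ℝ) * 2 := by positivity
    linarith
  rw [← ofReal_integral_eq_lintegral_ofReal hi (Filter.Eventually.of_forall fun r => by positivity)]
  congr 1
  have : ∀ t : ℝ, t ^ ((3:ℝ) - 1) = t ^ 2 := by intro t; norm_num
  simp_rw [this] at h
  rw [h, hG]
  norm_num
  field_simp

lemma Kr_meas : Measurable Kr := by unfold Kr; fun_prop

lemma Kr_int : ∫⁻ r : ℝ, ENNReal.ofReal (r ^ 2 * Kr r) = ENNReal.ofReal (π ^ 2) := by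
  have hM : Measurable (fun r : ℝ => ENNReal.ofReal (r ^ 2 * Kr r)) := by
    have := Kr_meas; fun_prop
  have hpos : ∫⁻ r in Set.Ioi (0:ℝ), ENNReal.ofReal (r ^ 2 * Kr r) = ENNReal.ofReal (π ^ 2 / 2) := by
    have e1 : ∫⁻ r in Set.Ioi (0:ℝ), ENNReal.ofReal (r ^ 2 * Kr r) =
        ∫⁻ r in Set.Ioi (0:ℝ), ∑' k : ℕ, ENNReal.ofReal (2 * (2 * (k:ℝ) + 1)) *
          ENNReal.ofReal (r ^ 2 * exp (-((2 * k + 1) * r))) := by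
      refine setLIntegral_congr_fun measurableSet_Ioi fun r hr => ?_
      have hs := (Kr_series r hr).mul_left (r ^ 2)
      rw [← hs.tsum_eq, ENNReal.ofReal_tsum_of_nonneg (fun k => by positivity) hs.summable]
      congr 1; ext k
      rw [← ENNReal.ofReal_mul (by positivity)]
      congr 1; ring
    rw [e1, lintegral_tsum (fun k => by fun_prop)]
    have e2 : ∀ k : ℕ, ∫⁻ r in Set.Ioi (0:ℝ), ENNReal.ofReal (2 * (2 * (k:ℝ) + 1)) *
          ENNReal.ofReal (r ^ 2 * exp (-((2 * k + 1) * r))) = ENNReal.ofReal (4 * (1 / (2 * (k:ℝ) + 1) ^ 2)) := by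
      intro k
      rw [lintegral_const_mul _ (by fun_prop), gamma_int _ (by positivity), ← ENNReal.ofReal_mul (by positivity)]
      congr 1
      field_simp; ring
    simp_rw [e2]
    have h4 := odd_sq_sum.mul_left 4
    rw [← ENNReal.ofReal_tsum_of_nonneg (fun k => by positivity) h4.summable, h4.tsum_eq]
    congr 1; ring
  have hneg : ∫⁻ r in Set.Iic (0:ℝ), ENNReal.ofReal (r ^ 2 * Kr r) = ∫⁻ r in Set.Ioi (0:ℝ), ENNReal.ofReal (r ^ 2 * Kr r) := by
    rw [setLIntegral_congr (Iio_ae_eq_Iic (a := (0:ℝ))).symm]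
    have := (Measure.measurePreserving_neg (volume : Measure ℝ)).setLIntegral_comp_preimage
      (s := Set.Iio (0:ℝ)) measurableSet_Iio hM
    rw [← this]
    simp [Kr_neg]
  rw [← lintegral_add_compl _ (measurableSet_Ioi (a := (0:ℝ))), Set.compl_Ioi, hneg, hpos,
    ← ENNReal.ofReal_add (by positivity) (by positivity)]
  congr 1; ring

/-- truncated linear profile -/
noncomputable def gL (L s : ℝ) : ℝ := -2 * min 0 (max s (-L))

lemma gL_lip (L s r : ℝ) : |gL L s - gL L (s + r)| ≤ 2 * |r| := by
  unfold gL
  have : -2 * min 0 (max s (-L)) - -2 * min 0 (max (s + r) (-L)) =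
    2 * (min 0 (max (s + r) (-L)) - min 0 (max s (-L))) := by ring
  rw [this, abs_mul, abs_two]
  have h1 := abs_min_sub_min_le_max 0 (max (s + r) (-L)) 0 (max s (-L))
  have h2 := abs_max_sub_max_le_abs (s + r) s (-L)
  simp at h1 h2
  linarith

lemma gL_cont (L : ℝ) : Continuous (gL L) := by unfold gL; fun_prop

lemma gL_tv_pos (L : ℝ) (hL : 0 < L) (r : ℝ) (hr : 0 ≤ r) :
    ∫⁻ s, ENNReal.ofReal |gL L s - gL L (s + r)| ≤ ENNReal.ofReal (2 * L * r) := by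
  have e1 : ∀ s, ENNReal.ofReal |gL L s - gL L (s + r)| =
      2 * ∫⁻ u in Set.Icc (-L) 0, (Set.Icc s (s + r)).indicator 1 u := by
    intro s
    rw [lintegral_indicator_one measurableSet_Icc, Measure.restrict_apply measurableSet_Icc,
      Set.Icc_inter_Icc, Real.volume_Icc]
    have : (2 : ENNReal) = ENNReal.ofReal 2 := by simp
    rw [this, ← ENNReal.ofReal_mul (by norm_num)]
    unfold gL
    have : -2 * min 0 (max s (-L)) - -2 * min 0 (max (s + r) (-L)) =
      2 * (min 0 (max (s + r) (-L)) - min 0 (max s (-L))) := by ring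
    rw [this, abs_mul, abs_two, abs_of_nonneg (by
      have := min_le_min_left 0 (max_le_max_right (-L) (show s ≤ s + r by linarith)); linarith)]
    by_cases hc : (s + r) ⊓ 0 - s ⊔ (-L) ≤ 0
    · rw [ENNReal.ofReal_of_nonpos (p := 2 * ((s + r) ⊓ 0 - s ⊔ (-L))) (by linarith)]
      rw [ENNReal.ofReal_eq_zero]
      grind
    · congr 2
      grind
  simp_rw [e1]
  rw [lintegral_const_mul' _ _ (by simp), lintegral_lintegral_swap]
  · have e2 : ∀ u : ℝ, ∫⁻ s, (Set.Icc s (s + r)).indicator (1 : ℝ → ENNReal) u = ENNReal.ofReal r := by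
      intro u
      have : ∀ s, (Set.Icc s (s + r)).indicator (1 : ℝ → ENNReal) u = (Set.Icc (u - r) u).indicator 1 s := by
        intro s
        simp only [Set.indicator, Set.mem_Icc, Pi.one_apply]
        congr 1
        apply propext
        constructor <;> rintro ⟨h1, h2⟩ <;> constructor <;> linarith
      simp_rw [this]
      rw [lintegral_indicator_one measurableSet_Icc, Real.volume_Icc]
      congr 1; ring
    simp_rw [e2]
    rw [lintegral_const, Measure.restrict_apply_univ, Real.volume_Icc]
    have : (2 : ENNReal) = ENNReal.ofReal 2 := by simp
    rw [this, ← ENNReal.ofReal_mul hr, ← ENNReal.ofReal_mul (by norm_num)]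
    apply le_of_eq; congr 1; ring
  · apply Measurable.aemeasurable
    have : (Function.uncurry fun s u => (Set.Icc s (s + r)).indicator (1 : ℝ → ENNReal) u) =
      Set.indicator {q : ℝ × ℝ | q.1 ≤ q.2 ∧ q.2 ≤ q.1 + r} 1 := by
      ext ⟨s, u⟩
      simp [Function.uncurry, Set.indicator]
    rw [this]
    apply Measurable.indicator measurable_one
    exact (measurableSet_le measurable_fst measurable_snd).inter
      (measurableSet_le measurable_snd (measurable_fst.add_const r))

lemma gL_tv (L : ℝ) (hL : 0 < L) (r : ℝ) :
    ∫⁻ s, ENNReal.ofReal |gL L s - gL L (s + r)| ≤ ENNReal.ofReal (2 * L * |r|) := by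
  rcases le_total 0 r with h | h
  · rw [abs_of_nonneg h]; exact gL_tv_pos L hL r h
  · have := gL_tv_pos L hL (-r) (by linarith)
    rw [abs_of_nonpos h]
    refine le_trans (le_of_eq ?_) this
    rw [← lintegral_sub_right_eq_self _ r]
    congr 1; ext s
    rw [abs_sub_comm]
    congr 4
    ring

lemma gL_sq (L : ℝ) (hL : 0 < L) (r : ℝ) :
    ∫⁻ s, ENNReal.ofReal ((gL L s - gL L (s + r)) ^ 2) ≤ ENNReal.ofReal (4 * L * r ^ 2) := by
  calc ∫⁻ s, ENNReal.ofReal ((gL L s - gL L (s + r)) ^ 2)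
      ≤ ∫⁻ s, ENNReal.ofReal (2 * |r|) * ENNReal.ofReal |gL L s - gL L (s + r)| := by
        apply lintegral_mono; intro s
        simp only
        rw [← ENNReal.ofReal_mul (by positivity)]
        apply ENNReal.ofReal_le_ofReal
        rw [← sq_abs, sq]
        exact mul_le_mul_of_nonneg_right (gL_lip L s r) (abs_nonneg _)
    _ = ENNReal.ofReal (2 * |r|) * ∫⁻ s, ENNReal.ofReal |gL L s - gL L (s + r)| :=
        lintegral_const_mul' _ _ ENNReal.ofReal_ne_top
    _ ≤ ENNReal.ofReal (2 * |r|) * ENNReal.ofReal (2 * L * |r|) := by gcongr; exact gL_tv L hL r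
    _ = _ := by
        rw [← ENNReal.ofReal_mul (by positivity)]
        congr 1
        rw [← sq_abs r]; ring

/-- truncated logarithm -/
noncomputable def VL (L x : ℝ) : ℝ := -2 * log (min 1 (max |x| (exp (-L))))

lemma VL_exp (L s : ℝ) : VL L (exp s) = gL L s := by
  unfold VL gL
  rw [abs_of_pos (exp_pos s), ← exp_monotone.map_max, ← exp_zero, ← exp_monotone.map_min, log_exp]

lemma VL_neg (L x : ℝ) : VL L (-x) = VL L x := by unfold VL; rw [abs_neg]

lemma VL_arg_ge (L x : ℝ) (hL : 0 < L) : exp (-L) ≤ min 1 (max |x| (exp (-L))) := by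
  apply le_min
  · rw [exp_le_one_iff]; linarith
  · exact le_max_right _ _

lemma VL_lip (L : ℝ) (hL : 0 < L) (x y : ℝ) : |VL L x - VL L y| ≤ 2 * exp L * |x - y| := by
  have key : ∀ p q : ℝ, exp (-L) ≤ p → exp (-L) ≤ q → log p - log q ≤ exp L * |p - q| := by
    intro p q hp hq
    have h0 := exp_pos (-L)
    have hp0 : 0 < p := by linarith
    have hq0 : 0 < q := by linarith
    rw [← log_div hp0.ne' hq0.ne']
    have h1 := log_le_sub_one_of_pos (div_pos hp0 hq0)
    have h2 : p / q - 1 = (p - q) * q⁻¹ := by field_simp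
    have h3 : q⁻¹ ≤ exp L := by
      have := inv_anti₀ h0 hq
      rwa [exp_neg, inv_inv] at this
    calc _ ≤ _ := h1
      _ = (p - q) * q⁻¹ := h2
      _ ≤ |p - q| * q⁻¹ := by gcongr; exact le_abs_self _
      _ ≤ |p - q| * exp L := by gcongr
      _ = _ := mul_comm _ _
  unfold VL
  set p := min 1 (max |x| (exp (-L))) with hp
  set q := min 1 (max |y| (exp (-L))) with hq
  have hpq : |p - q| ≤ |x - y| := by
    have h1 := abs_min_sub_min_le_max 1 (max |x| (exp (-L))) 1 (max |y| (exp (-L)))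
    have h2 := abs_max_sub_max_le_abs |x| |y| (exp (-L))
    have h3 := abs_abs_sub_abs_le x y
    simp at h1
    linarith
  have hp1 := VL_arg_ge L x hL
  have hq1 := VL_arg_ge L y hL
  have k1 := key p q hp1 hq1
  have k2 := key q p hq1 hp1
  rw [abs_sub_comm q p] at k2
  have : exp L * |p - q| ≤ exp L * |x - y| := by gcongr
  rw [abs_le]; constructor <;> linarith

lemma VL_cont (L : ℝ) (hL : 0 < L) : Continuous (VL L) := by
  unfold VL
  refine continuous_const.mul (Continuous.log (by fun_prop) fun x => ?_)
  have := VL_arg_ge L x hL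
  have := exp_pos (-L)
  linarith

lemma energy_bound (L : ℝ) (hL : 0 < L) :
    ∫⁻ x, ∫⁻ y, ENNReal.ofReal ((VL L x - VL L y) ^ 2 / (x - y) ^ 2) ≤ ENNReal.ofReal (8 * π ^ 2 * L) := by
  have hV := (VL_cont L hL).measurable
  have hg := (gL_cont L).measurable
  have hK := Kr_meas
  have hF : Measurable (fun q : ℝ × ℝ => ENNReal.ofReal ((VL L q.1 - VL L q.2) ^ 2 / (q.1 - q.2) ^ 2)) := by
    fun_prop
  have hG : Measurable (fun q : ℝ × ℝ => ENNReal.ofReal (Kr q.2) * ENNReal.ofReal ((gL L q.1 - gL L (q.1 + q.2)) ^ 2)) := by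
    fun_prop
  have inner : ∀ s σ : ℝ, (σ = 1 ∨ σ = -1) →
      ENNReal.ofReal (exp s) * ∫⁻ y, ENNReal.ofReal ((VL L (σ * exp s) - VL L y) ^ 2 / (σ * exp s - y) ^ 2)
      = ∫⁻ r, ENNReal.ofReal (Kr r) * ENNReal.ofReal ((gL L s - gL L (s + r)) ^ 2) := by
    intro s σ hσ
    rw [lintegral_pm _ (by fun_prop), ← lintegral_const_mul' _ _ ENNReal.ofReal_ne_top,
      ← lintegral_add_left_eq_self _ s]
    congr 1; ext r
    have hv : VL L (σ * exp s) = gL L s := by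
      rcases hσ with h | h <;> simp [h, VL_neg, VL_exp]
    rw [hv, VL_neg, VL_exp, ← ENNReal.ofReal_add (by positivity) (by positivity),
      ← ENNReal.ofReal_mul (exp_pos _).le, ← ENNReal.ofReal_mul (exp_pos _).le,
      ← ENNReal.ofReal_mul (Kr_nonneg r)]
    congr 1
    unfold Kr
    rw [exp_add]
    have hs := exp_pos s
    have e1 : exp s - exp s * exp r = exp s * (1 - exp r) := by ring
    have e2 : exp s - -(exp s * exp r) = exp s * (1 + exp r) := by ring
    have e3 : -exp s - exp s * exp r = -(exp s * (1 + exp r)) := by ring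
    have e4 : -exp s - -(exp s * exp r) = -(exp s * (1 - exp r)) := by ring
    have hp : 1 + exp r ≠ 0 := by positivity
    rcases hσ with h | h
    · rw [h, one_mul, e1, e2, mul_pow, mul_pow]
      simp only [div_eq_mul_inv, mul_inv]
      field_simp
    · rw [h, neg_one_mul, e3, e4, neg_sq, neg_sq, mul_pow, mul_pow]
      simp only [div_eq_mul_inv, mul_inv]
      field_simp
      ring
  have hF2 := hF.lintegral_prod_right' (ν := (volume : Measure ℝ))
  rw [lintegral_pm _ hF2]
  have e : ∀ s : ℝ, ENNReal.ofReal (exp s) * ((∫⁻ y, ENNReal.ofReal ((VL L (exp s) - VL L y) ^ 2 / (exp s - y) ^ 2))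
      + ∫⁻ y, ENNReal.ofReal ((VL L (-exp s) - VL L y) ^ 2 / (-exp s - y) ^ 2)) =
      2 * ∫⁻ r, ENNReal.ofReal (Kr r) * ENNReal.ofReal ((gL L s - gL L (s + r)) ^ 2) := by
    intro s
    have i1 := inner s 1 (Or.inl rfl)
    have i2 := inner s (-1) (Or.inr rfl)
    rw [one_mul] at i1
    rw [neg_one_mul] at i2
    rw [mul_add, i1, i2, two_mul]
  simp only [e]
  rw [lintegral_const_mul' _ _ (by simp), lintegral_lintegral_swap hG.aemeasurable]
  calc _ ≤ 2 * ∫⁻ r, ENNReal.ofReal (4 * L) * ENNReal.ofReal (r ^ 2 * Kr r) := by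
        gcongr with r
        rw [lintegral_const_mul' _ _ ENNReal.ofReal_ne_top]
        calc _ ≤ ENNReal.ofReal (Kr r) * ENNReal.ofReal (4 * L * r ^ 2) := by
              gcongr; exact gL_sq L hL r
          _ = _ := by
              rw [← ENNReal.ofReal_mul (Kr_nonneg r), ← ENNReal.ofReal_mul (by positivity)]
              congr 1; ring
    _ = _ := by
        rw [lintegral_const_mul' _ _ ENNReal.ofReal_ne_top, Kr_int]
        have : (2 : ENNReal) = ENNReal.ofReal 2 := by simp
        rw [this, ← ENNReal.ofReal_mul (by positivity), ← ENNReal.ofReal_mul (by norm_num)]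
        congr 1; ring

lemma energy_real (L : ℝ) (hL : 0 < L) :
    Integrable (fun q : ℝ × ℝ => (VL L (q.1 - 1) - VL L (q.2 - 1)) ^ 2 / (q.1 - q.2) ^ 2) ∧
    ∫ x, ∫ y, (VL L (x - 1) - VL L (y - 1)) ^ 2 / (x - y) ^ 2 ≤ 8 * π ^ 2 * L := by
  have hV := (VL_cont L hL).measurable
  have hF : Measurable (fun q : ℝ × ℝ => (VL L (q.1 - 1) - VL L (q.2 - 1)) ^ 2 / (q.1 - q.2) ^ 2) := by
    fun_prop
  have hb : ∫⁻ q : ℝ × ℝ, ENNReal.ofReal ((VL L (q.1 - 1) - VL L (q.2 - 1)) ^ 2 / (q.1 - q.2) ^ 2)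
      ≤ ENNReal.ofReal (8 * π ^ 2 * L) := by
    rw [Measure.volume_eq_prod, lintegral_prod _ (by fun_prop)]
    refine le_trans (le_of_eq ?_) (energy_bound L hL)
    rw [← lintegral_sub_right_eq_self (fun x => ∫⁻ y, ENNReal.ofReal ((VL L x - VL L y) ^ 2 / (x - y) ^ 2)) 1]
    congr 1; ext x
    rw [← lintegral_sub_right_eq_self (fun y => ENNReal.ofReal ((VL L (x - 1) - VL L y) ^ 2 / (x - 1 - y) ^ 2)) 1]
    simp
  have hi : Integrable (fun q : ℝ × ℝ => (VL L (q.1 - 1) - VL L (q.2 - 1)) ^ 2 / (q.1 - q.2) ^ 2) := by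
    refine ⟨hF.aestronglyMeasurable, ?_⟩
    rw [hasFiniteIntegral_iff_ofReal (Filter.Eventually.of_forall fun q => by positivity)]
    exact lt_of_le_of_lt hb ENNReal.ofReal_lt_top
  refine ⟨hi, ?_⟩
  have h1 := integral_prod _ hi
  simp only at h1
  rw [← h1]
  rw [← Measure.volume_eq_prod, integral_eq_lintegral_of_nonneg_ae (Filter.Eventually.of_forall fun q => by positivity) hF.aestronglyMeasurable]
  exact ENNReal.toReal_le_of_le_ofReal (by positivity) hb

lemma VL_nonneg (L x : ℝ) (hL : 0 < L) : 0 ≤ VL L x := by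
  unfold VL
  have h1 := VL_arg_ge L x hL
  have h2 := exp_pos (-L)
  have := log_nonpos (by linarith) (min_le_left 1 (max |x| (exp (-L))))
  linarith

lemma VL_le (L x : ℝ) (hL : 0 < L) : VL L x ≤ 2 * L := by
  unfold VL
  have h1 := VL_arg_ge L x hL
  have := log_le_log (exp_pos (-L)) h1
  rw [log_exp] at this
  linarith

lemma VL_zero (L x : ℝ) (hL : 0 < L) (hx : 1 ≤ |x|) : VL L x = 0 := by
  unfold VL
  rw [min_eq_left (le_max_of_le_left hx)]; simp

lemma VL_eq (L x : ℝ) (hL : 0 < L) (hx : |x| ≤ exp (-L)) : VL L x = 2 * L := by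
  unfold VL
  rw [max_eq_right hx, min_eq_right (by rw [exp_le_one_iff]; linarith), log_exp]; ring

lemma VL_le_log (L x : ℝ) (hL : 0 < L) (hx : |x| ≤ 1) (hx0 : x ≠ 0) : VL L x ≤ -2 * log x := by
  unfold VL
  have h1 : |x| ≤ min 1 (max |x| (exp (-L))) := le_min hx (le_max_left _ _)
  have := log_le_log (abs_pos.mpr hx0) h1
  rw [log_abs] at this
  linarith

lemma VL_L1 : ∃ C : ℝ, ∀ L : ℝ, 0 < L → Integrable (fun x => VL L (x - 1)) ∧ ∫ x, VL L (x - 1) ≤ C := by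
  have hlog : IntegrableOn (fun x : ℝ => -2 * log x) (Set.Icc (-1) 1) := by
    rw [integrableOn_Icc_iff_integrableOn_Ioc]
    have := (intervalIntegral.intervalIntegrable_log' (a := -1) (b := 1)).const_mul (-2)
    rwa [intervalIntegrable_iff_integrableOn_Ioc_of_le (by norm_num)] at this
  have hi := hlog.integrable_indicator measurableSet_Icc
  refine ⟨∫ x, (Set.Icc (-1) 1).indicator (fun x : ℝ => -2 * log x) x, fun L hL => ?_⟩
  have hle : ∀ᵐ x : ℝ, VL L x ≤ (Set.Icc (-1) 1).indicator (fun x : ℝ => -2 * log x) x := by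
    filter_upwards [compl_mem_ae_iff.mpr (measure_singleton (0:ℝ))] with x hx
    by_cases h : x ∈ Set.Icc (-1:ℝ) 1
    · rw [Set.indicator_of_mem h]
      exact VL_le_log L x hL (abs_le.mpr h) hx
    · rw [Set.indicator_of_notMem h, VL_zero L x hL]
      by_contra hc
      exact h (abs_le.mp (not_le.mp hc).le)
  have hV : Integrable (VL L) := by
    refine hi.mono' (VL_cont L hL).aestronglyMeasurable ?_
    filter_upwards [hle] with x hx
    rwa [norm_of_nonneg (VL_nonneg L x hL)]
  refine ⟨hV.comp_sub_right 1, ?_⟩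
  rw [integral_sub_right_eq_self (VL L) 1]
  exact integral_mono_ae hV hi hle

theorem onofri_aux (β : ℝ) (hβ : 1 < β) (w : ℝ → ℝ) (hw : Continuous w) (hwi : Integrable w)
    (hw0 : ∀ x, 0 ≤ w x) (hw1 : 0 < w 1) (M : ℝ) (hM : ∀ x, w x ≤ M) :
    ∃ v : ℝ → ℝ, (∃ L, LipschitzWith L v) ∧ HasCompactSupport v ∧
      (MeasureTheory.Integrable fun q : ℝ × ℝ => (v q.1 - v q.2) ^ 2 / (q.1 - q.2) ^ 2) ∧
      (1 / (4 * π * (2 * π * β))) * (∫ x : ℝ, ∫ y : ℝ, (v x - v y) ^ 2 / (x - y) ^ 2)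
          + (1 / (2 * π * β)) * (∫ x : ℝ, v x * w x) <
        Real.log ((1 / (2 * π * β)) * ∫ x : ℝ, Real.exp (v x) * w x) := by
  obtain ⟨C, hC⟩ := VL_L1
  have hM0 : 0 < M := lt_of_lt_of_le hw1 (hM 1)
  obtain ⟨δ, hδ, hδw⟩ : ∃ δ > 0, ∀ x, |x - 1| ≤ δ → w 1 / 2 ≤ w x := by
    have := hw.continuousAt.eventually (lt_mem_nhds (show w 1 / 2 < w 1 by linarith))
    obtain ⟨ε, hε, h⟩ := Metric.eventually_nhds_iff.mp this
    refine ⟨ε / 2, by linarith, fun x hx => (h ?_).le⟩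
    rw [dist_eq]; linarith
  set m := w 1 / 2 with hm
  have hm0 : 0 < m := by positivity
  set κ := 2 * π * β with hκ
  have hκ0 : 0 < κ := by positivity
  -- choice of L
  have hβ' : 0 < 1 - 1 / β := by
    have : 1 / β < 1 := by rw [div_lt_one (by linarith)]; exact hβ
    linarith
  obtain ⟨L, hL⟩ : ∃ L : ℝ, 0 < L ∧ -log δ ≤ L ∧ 1 / κ * (C * M) - log (2 * m / κ) < L * (1 - 1 / β) := by
    refine ⟨max 1 (max (-log δ) ((1 / κ * (C * M) - log (2 * m / κ)) / (1 - 1 / β) + 1)), ?_, ?_, ?_⟩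
    · exact lt_of_lt_of_le one_pos (le_max_left _ _)
    · exact le_max_of_le_right (le_max_left _ _)
    · rw [← div_lt_iff₀ hβ']
      refine lt_of_lt_of_le (lt_add_one _) (le_max_of_le_right (le_max_right _ _))
  obtain ⟨hL0, hLδ, hLbig⟩ := hL
  have hε : exp (-L) ≤ δ := by
    rw [← exp_log hδ, exp_le_exp]; linarith
  obtain ⟨hVi, hVC⟩ := hC L hL0
  obtain ⟨hEi, hE⟩ := energy_real L hL0
  have hvc : Continuous (fun x => VL L (x - 1)) := (VL_cont L hL0).comp (by fun_prop)
  refine ⟨fun x => VL L (x - 1), ⟨⟨2 * exp L, by positivity⟩, ?_⟩, ?_, hEi, ?_⟩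
  · refine LipschitzWith.of_dist_le_mul fun x y => ?_
    rw [dist_eq, dist_eq]
    have := VL_lip L hL0 (x - 1) (y - 1)
    rw [sub_sub_sub_cancel_right] at this
    exact this
  · refine HasCompactSupport.intro (isCompact_Icc (a := (0:ℝ)) (b := 2)) fun x hx => ?_
    apply VL_zero L _ hL0
    by_contra hc
    have := abs_le.mp (not_le.mp hc).le
    exact hx ⟨by linarith, by linarith⟩
  · have h1 : ∫ x, VL L (x - 1) * w x ≤ C * M := by
      calc _ ≤ ∫ x, VL L (x - 1) * M := by
            apply integral_mono_of_nonneg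
            · exact Filter.Eventually.of_forall fun x => mul_nonneg (VL_nonneg _ _ hL0) (hw0 x)
            · exact hVi.mul_const M
            · exact Filter.Eventually.of_forall fun x => mul_le_mul_of_nonneg_left (hM x) (VL_nonneg _ _ hL0)
        _ = (∫ x, VL L (x - 1)) * M := integral_mul_const _ _
        _ ≤ _ := by gcongr
    have hei : Integrable (fun x => exp (VL L (x - 1)) * w x) := by
      refine hwi.bdd_mul (c := exp (2 * L)) (continuous_exp.comp hvc).aestronglyMeasurable (Filter.Eventually.of_forall fun x => ?_)
      rw [norm_of_nonneg (exp_pos _).le]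
      exact exp_le_exp.mpr (VL_le _ _ hL0)
    have h2 : 2 * m * exp L ≤ ∫ x, exp (VL L (x - 1)) * w x := by
      calc 2 * m * exp L = ∫ x in Set.Icc (1 - exp (-L)) (1 + exp (-L)), exp (2 * L) * m := by
            rw [setIntegral_const, Measure.real, Real.volume_Icc, ENNReal.toReal_ofReal (by have := exp_pos (-L); linarith)]
            have : exp (2 * L) = exp L * exp L := by rw [← exp_add]; ring_nf
            rw [this, exp_neg, smul_eq_mul]
            field_simp; ring
        _ ≤ ∫ x in Set.Icc (1 - exp (-L)) (1 + exp (-L)), exp (VL L (x - 1)) * w x := by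
            refine setIntegral_mono_on (integrableOn_const (by simp [Real.volume_Icc])) hei.integrableOn measurableSet_Icc fun x hx => ?_
            have hx' : |x - 1| ≤ exp (-L) := abs_le.mpr ⟨by linarith [hx.1], by linarith [hx.2]⟩
            rw [VL_eq L _ hL0 hx']
            gcongr
            exact hδw x (hx'.trans hε)
        _ ≤ _ := setIntegral_le_integral hei (Filter.Eventually.of_forall fun x => mul_nonneg (exp_pos _).le (hw0 x))
    have h3 : log (2 * m / κ) + L ≤ log (1 / κ * ∫ x, exp (VL L (x - 1)) * w x) := by
      rw [← log_exp L, ← log_mul (by positivity) (exp_pos _).ne', log_exp]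
      apply log_le_log (by positivity)
      calc 2 * m / κ * exp L = 1 / κ * (2 * m * exp L) := by ring
        _ ≤ _ := by gcongr
    have h4 : 1 / (4 * π * κ) * (∫ x : ℝ, ∫ y : ℝ, (VL L (x - 1) - VL L (y - 1)) ^ 2 / (x - y) ^ 2) ≤ L * (1 / β) := by
      calc _ ≤ 1 / (4 * π * κ) * (8 * π ^ 2 * L) := by gcongr
        _ = _ := by
          rw [hκ]
          have := pi_pos
          field_simp; ring
    have h5 : 1 / κ * (∫ x, VL L (x - 1) * w x) ≤ 1 / κ * (C * M) := by gcongr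
    have h6 : L * (1 - 1 / β) = L - L * (1 / β) := by ring
    linarith

theorem stmt_5 (b : ℝ) (hb : b ∈ Set.Ioo (-1 : ℝ) 0)
    (η : ℝ → ℝ)
    (hη : ∀ x : ℝ, η x =
      Real.log (2 * (1 - b) * Real.cos (π * b / 2) /
        (|x| ^ (2 * (1 - b)) + 2 * |x| ^ (1 - b) * Real.sin (π * b / 2) + 1)))
    (κ : ℝ) (hκ : κ = 2 * π * (1 - b)) :
    ∃ v : ℝ → ℝ, (∃ L, LipschitzWith L v) ∧ HasCompactSupport v ∧
      (MeasureTheory.Integrable fun q : ℝ × ℝ => (v q.1 - v q.2) ^ 2 / (q.1 - q.2) ^ 2) ∧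
      (1 / (4 * π * κ)) * (∫ x : ℝ, ∫ y : ℝ, (v x - v y) ^ 2 / (x - y) ^ 2)
          + (1 / κ) * (∫ x : ℝ, v x * Real.exp (η x) * |x| ^ (-b)) <
        Real.log ((1 / κ) * ∫ x : ℝ, Real.exp (v x) * Real.exp (η x) * |x| ^ (-b)) := by
  obtain ⟨hb1, hb2⟩ := hb
  have hpi := pi_pos
  have hcos : 0 < cos (π * b / 2) := cos_pos_of_mem_Ioo ⟨by nlinarith, by nlinarith⟩
  set s := sin (π * b / 2) with hs
  have hs1 : -1 < s := by
    have h := sin_sq_add_cos_sq (π * b / 2)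
    rw [← hs] at h
    nlinarith
  have hs0 : s ≤ 0 := sin_nonpos_of_nonpos_of_neg_pi_le (by nlinarith) (by nlinarith)
  set A := 2 * (1 - b) * cos (π * b / 2) with hA
  have hA0 : 0 < A := by
    have : 0 < 1 - b := by linarith
    positivity
  set D : ℝ → ℝ := fun x => |x| ^ (2 * (1 - b)) + 2 * |x| ^ (1 - b) * s + 1 with hD
  have hsq : ∀ x : ℝ, |x| ^ (2 * (1 - b)) = (|x| ^ (1 - b)) ^ 2 := by
    intro x
    rw [mul_comm, rpow_mul (abs_nonneg x)]; norm_num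
  have hDlow : ∀ x, (1 + s) * ((|x| ^ (1 - b)) ^ 2 + 1) ≤ D x := by
    intro x
    simp only [hD]
    rw [hsq]
    nlinarith [sq_nonneg (|x| ^ (1 - b) - 1)]
  have hDpos : ∀ x, 0 < D x := fun x => lt_of_lt_of_le (by have : 0 < 1 + s := by linarith
                                                           positivity) (hDlow x)
  have heta : ∀ x, exp (η x) = A / D x := by
    intro x
    rw [hη x, exp_log (div_pos hA0 (hDpos x))]
  have hDc : Continuous D := by
    simp only [hD]
    have c1 : Continuous (fun x : ℝ => |x| ^ (2 * (1 - b))) := continuous_abs.rpow_const fun x => Or.inr (by linarith)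
    have c2 : Continuous (fun x : ℝ => |x| ^ (1 - b)) := continuous_abs.rpow_const fun x => Or.inr (by linarith)
    fun_prop
  set w : ℝ → ℝ := fun x => exp (η x) * |x| ^ (-b) with hw
  have hwe : ∀ x, w x = A / D x * |x| ^ (-b) := fun x => by simp only [hw, heta]
  have hwc : Continuous w := by
    rw [funext hwe]
    have c3 : Continuous (fun x : ℝ => |x| ^ (-b)) := continuous_abs.rpow_const fun x => Or.inr (by linarith)
    exact (continuous_const.div hDc fun x => (hDpos x).ne').mul c3
  have hwn : ∀ x, 0 ≤ w x := fun x => by simp only [hw]; positivity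
  set B := 2 * A / (1 + s) with hB
  have hs2 : 0 < 1 + s := by linarith
  have hB0 : 0 < B := by positivity
  have hwb : ∀ x, w x ≤ B * (1 + x ^ 2)⁻¹ := by
    intro x
    rw [hwe]
    have hd := hDlow x
    have hp : |x| ^ (-b) * (1 + x ^ 2) ≤ 2 * ((|x| ^ (1 - b)) ^ 2 + 1) := by
      rw [← sq_abs x]
      rcases le_total |x| 1 with h | h
      · have h1 : |x| ^ (-b) ≤ 1 := rpow_le_one (abs_nonneg x) h (by linarith)
        have h2 : |x| ^ 2 ≤ 1 := by nlinarith [abs_nonneg x]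
        have h3 : 0 ≤ |x| ^ (-b) := by positivity
        have : |x| ^ (-b) * (1 + |x| ^ 2) ≤ 1 * (1 + 1) := by gcongr
        nlinarith [sq_nonneg (|x| ^ (1 - b))]
      · have hx0 : 0 < |x| := by linarith
        have h1 : |x| ^ (1 - b) = |x| * |x| ^ (-b) := by
          rw [sub_eq_add_neg, rpow_add hx0, rpow_one]
        have h3 : 1 ≤ |x| ^ (-b) := one_le_rpow h (by linarith)
        rw [h1]
        have h4 : 1 ≤ |x| ^ 2 := by nlinarith
        have h5 : |x| ^ (-b) ≤ (|x| ^ (-b)) ^ 2 := by nlinarith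
        calc |x| ^ (-b) * (1 + |x| ^ 2) ≤ (|x| ^ (-b)) ^ 2 * (|x| ^ 2 + |x| ^ 2) := by gcongr
          _ ≤ _ := by nlinarith
    have hd0 := hDpos x
    rw [hB, div_mul_eq_mul_div, div_le_iff₀ hd0, ← div_eq_mul_inv, div_div, div_mul_eq_mul_div, le_div_iff₀ (by positivity)]
    calc A * |x| ^ (-b) * ((1 + s) * (1 + x ^ 2)) = A * (1 + s) * (|x| ^ (-b) * (1 + x ^ 2)) := by ring
      _ ≤ A * (1 + s) * (2 * ((|x| ^ (1 - b)) ^ 2 + 1)) := by gcongr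
      _ = 2 * A * ((1 + s) * ((|x| ^ (1 - b)) ^ 2 + 1)) := by ring
      _ ≤ _ := by gcongr
  have hwi : Integrable w := by
    refine (integrable_inv_one_add_sq.const_mul B).mono' hwc.aestronglyMeasurable (Filter.Eventually.of_forall fun x => ?_)
    rw [norm_of_nonneg (hwn x)]; exact hwb x
  have hwM : ∀ x, w x ≤ B := fun x => (hwb x).trans (by
    have : (1 + x ^ 2)⁻¹ ≤ 1 := inv_le_one_of_one_le₀ (by nlinarith)
    nlinarith)
  have hw1 : 0 < w 1 := by
    rw [hwe]; simpa using div_pos hA0 (hDpos 1)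
  have := onofri_aux (1 - b) (by linarith) w hwc hwi hwn hw1 B hwM
  rw [← hκ] at this
  simpa only [hw, mul_assoc] using this
end

section
/- For every smooth compactly supported function v : ℝ → ℝ one has log( (1/(2π)) ∫_ℝ e^{v(x)} · (2/(1+x²)) dx ) ≤ (1/(8π²)) ∫_ℝ∫_ℝ (v(x)−v(y))²/(x−y)² dx dy + (1/(2π)) ∫_ℝ v(x) · (2/(1+x²)) dx. -/
open MeasureTheory Real

lemma lm_growth (β d : ℕ → ℝ) (hβ : ∀ n, 0 ≤ β n) (hd : ∀ n, 0 ≤ d n) (h0 : β 0 ≤ 1)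
    (hrec : ∀ n : ℕ, n * β n ≤ ∑ k ∈ Finset.range (n + 1), k * d k * β (n - k)) (M : ℕ) :
    ∑ n ∈ Finset.range M, β n ≤ Real.exp (∑ k ∈ Finset.range M, d k) := by
  set P : ℝ → ℝ := fun t => ∑ n ∈ Finset.range M, β n * t ^ n with hP
  set D : ℝ → ℝ := fun t => ∑ n ∈ Finset.range M, d n * t ^ n with hD
  set P' : ℝ → ℝ := fun t => ∑ n ∈ Finset.range M, β n * (n * t ^ (n - 1)) with hP'
  set D' : ℝ → ℝ := fun t => ∑ n ∈ Finset.range M, d n * (n * t ^ (n - 1)) with hD'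
  have hPd : ∀ t, HasDerivAt P (P' t) t := fun t =>
    HasDerivAt.fun_sum fun n _ => (hasDerivAt_pow n t).const_mul (β n)
  have hDd : ∀ t, HasDerivAt D (D' t) t := fun t =>
    HasDerivAt.fun_sum fun n _ => (hasDerivAt_pow n t).const_mul (d n)
  have hφ : ∀ t, HasDerivAt (fun t => P t * Real.exp (-D t))
      (P' t * Real.exp (-D t) + P t * (Real.exp (-D t) * (-D' t))) t := fun t =>
    (hPd t).mul ((hDd t).neg.exp)
  have aux : ∀ (c : ℕ → ℝ) (t : ℝ), t * ∑ n ∈ Finset.range M, c n * (n * t ^ (n - 1))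
      = ∑ n ∈ Finset.range M, n * c n * t ^ n := by
    intro c t
    rw [Finset.mul_sum]
    refine Finset.sum_congr rfl fun n _ => ?_
    rcases n with _ | n
    · simp
    · simp [pow_succ]; ring
  have key : ∀ t, 0 < t → P' t ≤ D' t * P t := by
    intro t ht
    refine le_of_mul_le_mul_left ?_ ht
    rw [← mul_assoc, hP', hD', hP]
    simp only
    rw [aux, aux]
    calc ∑ n ∈ Finset.range M, n * β n * t ^ n
        ≤ ∑ n ∈ Finset.range M, ∑ k ∈ Finset.range (n + 1),
            (k * d k * t ^ k) * (β (n - k) * t ^ (n - k)) := by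
          refine Finset.sum_le_sum fun n _ => ?_
          refine (mul_le_mul_of_nonneg_right (hrec n) (by positivity)).trans (le_of_eq ?_)
          rw [Finset.sum_mul]
          refine Finset.sum_congr rfl fun k hk => ?_
          have : t ^ n = t ^ k * t ^ (n - k) := by
            rw [← pow_add]; congr 1; have := Finset.mem_range.1 hk; omega
          rw [this]; ring
      _ = ∑ k ∈ Finset.range M, ∑ m ∈ Finset.range (M - k),
            (k * d k * t ^ k) * (β m * t ^ m) :=
          Finset.sum_range_diag_flip M (fun k m => (k * d k * t ^ k) * (β m * t ^ m))
      _ ≤ ∑ k ∈ Finset.range M, ∑ m ∈ Finset.range M,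
            (k * d k * t ^ k) * (β m * t ^ m) := by
          refine Finset.sum_le_sum fun k _ => ?_
          refine Finset.sum_le_sum_of_subset_of_nonneg ?_ ?_
          · exact Finset.range_subset_range.2 (Nat.sub_le _ _)
          · intro m _ _
            have := hβ m
            have := hd k
            positivity
      _ = _ := by rw [Finset.sum_mul_sum]
  have anti : AntitoneOn (fun t => P t * Real.exp (-D t)) (Set.Icc 0 1) := by
    refine antitoneOn_of_deriv_nonpos (convex_Icc 0 1)
      (fun t _ => (hφ t).continuousAt.continuousWithinAt)
      (fun t _ => (hφ t).differentiableAt.differentiableWithinAt) ?_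
    intro t ht
    rw [interior_Icc] at ht
    rw [(hφ t).deriv]
    have := key t ht.1
    have e := Real.exp_pos (-D t)
    nlinarith
  have h01 := anti (a := 0) (b := 1) (by simp) (by simp) zero_le_one
  simp only at h01
  have hP0 : P 0 ≤ 1 := by
    rcases M with _ | M
    · simp [hP]
    · simp [hP, Finset.sum_range_succ', h0]
  have hD0 : 0 ≤ D 0 := Finset.sum_nonneg fun n _ => mul_nonneg (hd n) (by positivity)
  have hPn : 0 ≤ P 0 := Finset.sum_nonneg fun n _ => mul_nonneg (hβ n) (by positivity)
  have e0 : Real.exp (-D 0) ≤ 1 := Real.exp_le_one_iff.2 (by linarith)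
  have h1 : P 1 * Real.exp (-D 1) ≤ 1 := by
    have := Real.exp_pos (-D 0)
    nlinarith
  have hP1 : P 1 = ∑ n ∈ Finset.range M, β n := by simp [hP]
  have hD1 : D 1 = ∑ n ∈ Finset.range M, d n := by simp [hD]
  rw [← hP1, ← hD1]
  rw [Real.exp_neg, ← div_eq_mul_inv, div_le_one (Real.exp_pos _)] at h1
  exact h1

instance instTwoPiPosFact : Fact (0 < 2 * π) := Fact.mk Real.two_pi_pos

lemma parseval_memLp (f : AddCircle (2 * π) → ℂ) (hf : MemLp f 2 AddCircle.haarAddCircle) :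
    HasSum (fun i => ‖fourierCoeff f i‖ ^ 2)
      (∫ t : AddCircle (2 * π), ‖f t‖ ^ 2 ∂AddCircle.haarAddCircle) := by
  have h := hasSum_sq_fourierCoeff hf.toLp
  have e := hf.coeFn_toLp
  have h1 : (∫ t : AddCircle (2 * π), ‖hf.toLp f t‖ ^ 2 ∂AddCircle.haarAddCircle)
      = ∫ t : AddCircle (2 * π), ‖f t‖ ^ 2 ∂AddCircle.haarAddCircle := by
    refine integral_congr_ae ?_
    filter_upwards [e] with t ht
    rw [ht]
  rw [h1, fourierCoeff_congr_ae e] at h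
  exact h

lemma fourier_one_coe (θ : ℝ) :
    fourier 1 (θ : AddCircle (2 * π)) = circleMap 0 1 θ := by
  rw [fourier_coe_apply]
  have : (2 * π : ℂ) ≠ 0 := by exact_mod_cast Real.two_pi_pos.ne'
  simp only [circleMap, zero_add, Complex.ofReal_one, one_mul, Int.cast_one]
  congr 1
  push_cast
  field_simp

lemma fourier_eq_zpow (n : ℤ) (t : AddCircle (2 * π)) : fourier n t = (fourier 1 t) ^ n := by
  simp [fourier_apply, AddCircle.toCircle_zsmul]

lemma haar_eq_avg {E : Type*} [NormedAddCommGroup E] [NormedSpace ℝ E] (F : ℂ → E) :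
    ∫ t : AddCircle (2 * π), F (fourier 1 t) ∂AddCircle.haarAddCircle = circleAverage F 0 1 := by
  rw [AddCircle.integral_haarAddCircle, ← AddCircle.intervalIntegral_preimage _ 0,
    circleAverage_def, zero_add]
  simp_rw [fourier_one_coe]

lemma coeff_eq_avg (g : ℂ → ℂ) (n : ℤ) :
    fourierCoeff (fun t : AddCircle (2 * π) => g (fourier 1 t)) n
      = circleAverage (fun z => z ^ (-n) * g z) 0 1 := by
  rw [← haar_eq_avg, fourierCoeff]
  simp_rw [fourier_eq_zpow (-n), smul_eq_mul]

lemma cont_zpow_circle (n : ℤ) : Continuous (fun θ : ℝ => (circleMap 0 1 θ) ^ n) := by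
  refine (continuous_circleMap 0 1).zpow₀ n fun θ => Or.inl ?_
  exact circleMap_ne_center one_ne_zero

/-- recursion for the coefficients of `exp f`. -/
lemma coeff_rec (a : ℕ → ℂ) (N : ℕ) (g : ℂ → ℂ)
    (hg : g = fun z => Complex.exp (∑ k ∈ Finset.range N, a k * z ^ k)) (n : ℤ) :
    n * circleAverage (fun z => z ^ (-n) * g z) 0 1
      = ∑ k ∈ Finset.range N, k * a k * circleAverage (fun z => z ^ (-(n - k)) * g z) 0 1 := by
  have hgc : Continuous g := by rw [hg]; fun_prop
  have hne : ∀ θ : ℝ, circleMap 0 1 θ ≠ 0 := fun θ => circleMap_ne_center one_ne_zero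
  have hcont : ∀ m : ℤ, Continuous fun θ : ℝ => circleMap 0 1 θ ^ m * g (circleMap 0 1 θ) :=
    fun m => (cont_zpow_circle m).mul (hgc.comp (continuous_circleMap 0 1))
  have hgd : ∀ z, HasDerivAt g
      (g z * ∑ k ∈ Finset.range N, a k * (k * z ^ (k - 1))) z := by
    intro z
    rw [hg]
    exact (HasDerivAt.fun_sum fun k _ => (hasDerivAt_pow k z).const_mul (a k)).cexp
  set R : ℝ → ℂ := fun θ => -n * (circleMap 0 1 θ ^ (-n) * g (circleMap 0 1 θ))
    + ∑ k ∈ Finset.range N, k * a k * (circleMap 0 1 θ ^ (-(n - k)) * g (circleMap 0 1 θ)) with hR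
  have hd : ∀ θ : ℝ, HasDerivAt (fun θ : ℝ => circleMap 0 1 θ ^ (-n) * g (circleMap 0 1 θ))
      (Complex.I * R θ) θ := by
    intro θ
    have h1 := hasDerivAt_circleMap 0 1 θ
    have h2 := ((hasDerivAt_zpow (-n) (circleMap 0 1 θ) (Or.inl (hne θ))).mul
      (hgd (circleMap 0 1 θ))).comp θ h1
    refine h2.congr_deriv ?_
    rw [hR]
    set z := circleMap 0 1 θ with hz
    have hz0 : z ≠ 0 := hne θ
    simp only
    have e1 : z ^ (-n - 1) * z = z ^ (-n) := by
      rw [← zpow_add_one₀ hz0]; congr 1; ring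
    have e2 : (∑ k ∈ Finset.range N, a k * (k * z ^ (k - 1))) * z * z ^ (-n)
        = ∑ k ∈ Finset.range N, k * a k * z ^ (-(n - k)) := by
      rw [Finset.sum_mul, Finset.sum_mul]
      refine Finset.sum_congr rfl fun k _ => ?_
      rcases k with _ | k
      · simp
      · have : z ^ (-(n - (k + 1 : ℕ))) = z ^ (-n) * z ^ k * z := by
          rw [← zpow_natCast, ← zpow_add₀ hz0, ← zpow_add_one₀ hz0]; congr 1; push_cast; ring
        rw [this]; simp; ring
    have e3 : ∑ k ∈ Finset.range N, k * a k * (z ^ (-(n - k)) * g z)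
        = (∑ k ∈ Finset.range N, k * a k * z ^ (-(n - k))) * g z := by
      rw [Finset.sum_mul]; refine Finset.sum_congr rfl fun k _ => by ring
    rw [e3, ← e2, ← e1]
    push_cast
    ring
  have hRc : Continuous R := by
    refine (continuous_const.mul (hcont _)).add ?_
    exact continuous_finsetSum _ fun k _ => continuous_const.mul (hcont _)
  have hintg := intervalIntegral.integral_eq_sub_of_hasDerivAt (a := 0) (b := 2 * π)
    (fun θ _ => hd θ) ((continuous_const.mul hRc).intervalIntegrable _ _)
  have hper : circleMap 0 1 (2 * π) = circleMap 0 1 0 := by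
    simp [circleMap]
  rw [hper, sub_self, intervalIntegral.integral_const_mul] at hintg
  have hR0 : ∫ θ in (0)..(2 * π), R θ = 0 := by
    simpa using hintg
  have hci : ∀ (c : ℂ) (m : ℤ), IntervalIntegrable
      (fun θ : ℝ => c * (circleMap 0 1 θ ^ m * g (circleMap 0 1 θ))) volume 0 (2 * π) :=
    fun c m => (continuous_const.mul (hcont m)).intervalIntegrable _ _
  have hci2 : IntervalIntegrable (fun θ : ℝ => ∑ k ∈ Finset.range N,
      k * a k * (circleMap 0 1 θ ^ (-(n - k)) * g (circleMap 0 1 θ))) volume 0 (2 * π) :=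
    (continuous_finsetSum _ fun k _ => continuous_const.mul (hcont _)).intervalIntegrable _ _
  simp only [hR] at hR0
  rw [intervalIntegral.integral_add (hci _ _) hci2,
    intervalIntegral.integral_finsetSum (fun k _ => hci _ _)] at hR0
  simp_rw [intervalIntegral.integral_const_mul] at hR0
  simp only [circleAverage_def, Complex.real_smul]
  have := eq_neg_of_add_eq_zero_left hR0
  have h4 : (n : ℂ) * ∫ θ in (0)..(2 * π), circleMap 0 1 θ ^ (-n) * g (circleMap 0 1 θ)
      = ∑ k ∈ Finset.range N, k * a k *
        ∫ θ in (0)..(2 * π), circleMap 0 1 θ ^ (-(n - k)) * g (circleMap 0 1 θ) := by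
    linear_combination -hR0
  rw [mul_left_comm, h4, Finset.mul_sum]
  exact Finset.sum_congr rfl fun k _ => by ring

lemma coeff_neg (g : ℂ → ℂ) (hg : Differentiable ℂ g) (m : ℕ) :
    circleAverage (fun z => z ^ (-(-(m : ℤ))) * g z) 0 1 = 0 ^ m * g 0 := by
  have : (fun z : ℂ => z ^ (-(-(m : ℤ))) * g z) = fun z => z ^ m * g z := by
    funext z; rw [neg_neg, zpow_natCast]
  rw [this]
  exact DiffContOnCl.circleAverage (f := fun z => z ^ m * g z)
    (Differentiable.diffContOnCl (by fun_prop))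

lemma lebedev_milin (a : ℕ → ℂ) (N : ℕ) (h0 : a 0 = 0) (hN : ∀ k, N ≤ k → a k = 0) :
    ∫ t : AddCircle (2 * π),
      ‖Complex.exp (∑ k ∈ Finset.range N, a k * (fourier 1 t) ^ k)‖ ^ 2 ∂AddCircle.haarAddCircle
      ≤ Real.exp (∑ k ∈ Finset.range N, k * ‖a k‖ ^ 2) := by
  set g : ℂ → ℂ := fun z => Complex.exp (∑ k ∈ Finset.range N, a k * z ^ k) with hg
  have hgd : Differentiable ℂ g := by rw [hg]; fun_prop
  set b : ℤ → ℂ := fun n => circleAverage (fun z => z ^ (-n) * g z) 0 1 with hb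
  have hb0 : b 0 = 1 := by
    have := coeff_neg g hgd 0
    simp only [hb]
    simp only [Nat.cast_zero, neg_zero] at this ⊢
    rw [this, hg]
    simp only [pow_zero, one_mul]
    rw [Finset.sum_eq_zero, Complex.exp_zero]
    intro k _
    rcases k with _ | k <;> simp [h0]
  have hbn : ∀ n : ℤ, n < 0 → b n = 0 := by
    intro n hn
    obtain ⟨m, hm⟩ := Int.exists_eq_neg_ofNat hn.le
    have := coeff_neg g hgd m
    rw [hm]
    simp only [hb]
    rw [this, zero_pow, zero_mul]
    omega
  have hrec : ∀ n : ℕ, (n : ℂ) * b n = ∑ k ∈ Finset.Ico 1 (n + 1), k * a k * b ((n - k : ℕ)) := by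
    intro n
    have h := coeff_rec a N g hg n
    have h' : (n : ℂ) * b n = ∑ k ∈ Finset.range N, k * a k * b (n - k) := by
      rw [Int.cast_natCast] at h
      exact h
    rw [h']
    have s1 : ∑ k ∈ Finset.range N, (k : ℂ) * a k * b (n - k)
        = ∑ k ∈ Finset.range (N + n + 1), (k : ℂ) * a k * b (n - k) := by
      refine Finset.sum_subset (Finset.range_subset_range.2 (by omega)) fun k _ hk => ?_
      rw [hN k (by simpa using hk)]; simp
    have s2 : ∑ k ∈ Finset.Ico 1 (n + 1), (k : ℂ) * a k * b (n - k)
        = ∑ k ∈ Finset.range (N + n + 1), (k : ℂ) * a k * b (n - k) := by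
      refine Finset.sum_subset ?_ fun k _ hk => ?_
      · intro k hk
        simp only [Finset.mem_Ico, Finset.mem_range] at *
        omega
      · rcases Nat.eq_zero_or_pos k with rfl | hk0
        · simp
        · rw [hbn, mul_zero]
          simp only [Finset.mem_Ico] at hk
          omega
    rw [s1, ← s2]
    refine Finset.sum_congr rfl fun k hk => ?_
    simp only [Finset.mem_Ico] at hk
    rw [Nat.cast_sub (by omega)]
  have hpar : HasSum (fun i => ‖b i‖ ^ 2)
      (∫ t : AddCircle (2 * π), ‖g (fourier 1 t)‖ ^ 2 ∂AddCircle.haarAddCircle) := by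
    have hc : Continuous fun t : AddCircle (2 * π) => g (fourier 1 t) :=
      hgd.continuous.comp (fourier 1).continuous
    have := parseval_memLp (fun t => g (fourier 1 t))
      (MemLp.of_bound hc.aestronglyMeasurable ‖(⟨_, hc⟩ : C(AddCircle (2 * π), ℂ))‖
        (Filter.Eventually.of_forall fun t => ContinuousMap.norm_coe_le_norm ⟨_, hc⟩ t))
    simpa only [coeff_eq_avg] using this
  have hparN : HasSum (fun i : ℕ => ‖b i‖ ^ 2)
      (∫ t : AddCircle (2 * π), ‖g (fourier 1 t)‖ ^ 2 ∂AddCircle.haarAddCircle) := by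
    refine (Function.Injective.hasSum_iff (f := fun i : ℤ => ‖b i‖ ^ 2)
      (g := fun n : ℕ => (n : ℤ)) Nat.cast_injective ?_).2 hpar
    intro x hx
    rw [hbn x, norm_zero]
    · norm_num
    · by_contra h
      exact hx ⟨x.toNat, by simp; omega⟩
  refine le_of_tendsto' hparN.tendsto_sum_nat fun M => ?_
  refine (lm_growth (fun n => ‖b n‖ ^ 2) (fun k => k * ‖a k‖ ^ 2) (fun n => by positivity)
    (fun n => by positivity) (by simp [hb0]) ?_ M).trans ?_
  · intro n
    rcases Nat.eq_zero_or_pos n with rfl | hn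
    · simp
    have h1 : (n : ℝ) * ‖b n‖ ≤ ∑ k ∈ Finset.Ico 1 (n + 1), k * ‖a k‖ * ‖b ((n - k : ℕ))‖ := by
      have := congrArg norm (hrec n)
      rw [norm_mul, Complex.norm_natCast] at this
      rw [this]
      refine (norm_sum_le _ _).trans (le_of_eq ?_)
      simp
    have h2 := sq_sum_le_card_mul_sum_sq (s := Finset.Ico 1 (n + 1))
      (f := fun k : ℕ => k * ‖a k‖ * ‖b ((n - k : ℕ))‖)
    have h3 : ((n : ℝ) * ‖b n‖) ^ 2 ≤ (∑ k ∈ Finset.Ico 1 (n + 1), k * ‖a k‖ * ‖b ((n - k : ℕ))‖) ^ 2 := by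
      gcongr
    have h4 := h3.trans h2
    simp only [Nat.card_Ico, Nat.add_sub_cancel] at h4
    have hn' : (0 : ℝ) < n := by exact_mod_cast hn
    have h5 : (n : ℝ) * ‖b n‖ ^ 2 ≤ ∑ k ∈ Finset.Ico 1 (n + 1), (k * ‖a k‖ * ‖b ((n - k : ℕ))‖) ^ 2 := by
      refine le_of_mul_le_mul_left ?_ hn'
      linarith
    refine h5.trans ?_
    rw [Finset.range_eq_Ico, Finset.sum_eq_sum_Ico_succ_bot (by omega : 0 < n + 1)]
    simp only [CharP.cast_eq_zero, zero_mul, zero_add]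
    refine le_of_eq (Finset.sum_congr rfl fun k _ => by ring)
  · refine Real.exp_le_exp.2 ?_
    have s1 : ∑ k ∈ Finset.range N, (k : ℝ) * ‖a k‖ ^ 2
        = ∑ k ∈ Finset.range (M + N), (k : ℝ) * ‖a k‖ ^ 2 := by
      refine Finset.sum_subset (Finset.range_subset_range.2 (by omega)) fun k _ hk => ?_
      rw [hN k (by simpa using hk)]; simp
    rw [s1]
    exact Finset.sum_le_sum_of_subset_of_nonneg (Finset.range_subset_range.2 (by omega))
      fun k _ _ => by positivity

/-- abbreviation for the normalized Haar measure on the circle -/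
noncomputable abbrev muC : Measure (AddCircle (2 * π)) := AddCircle.haarAddCircle

lemma muC_singleton : muC {0} = 0 := by
  have h := AddCircle.volume_closedBall (T := 2 * π) (x := 0) 0
  rw [Metric.closedBall_zero, AddCircle.volume_eq_smul_haarAddCircle] at h
  simp only [Measure.smul_apply, smul_eq_mul, mul_zero] at h
  rw [min_eq_right Real.two_pi_pos.le, ENNReal.ofReal_zero] at h
  rcases mul_eq_zero.1 h with h | h
  · exact absurd h (by simpa using Real.pi_pos)
  · exact h

lemma pairing_hasSum (f g : AddCircle (2 * π) → ℂ) (hf : MemLp f 2 muC) (hg : MemLp g 2 muC) :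
    HasSum (fun k : ℤ => fourierCoeff f k * ∫ t, fourier k t * (starRingEnd ℂ) (g t) ∂muC)
      (∫ t, f t * (starRingEnd ℂ) (g t) ∂muC) := by
  have h := hasSum_fourier_series_L2 hf.toLp
  have h2 := h.mapL (innerSL ℂ hg.toLp)
  have ef := hf.coeFn_toLp
  have eg := hg.coeFn_toLp
  have e1 : (fun k : ℤ => fourierCoeff f k * ∫ t, fourier k t * (starRingEnd ℂ) (g t) ∂muC)
      = fun b => ((innerSL ℂ) hg.toLp) (fourierCoeff hf.toLp b • fourierLp 2 b) := by
    funext k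
    simp only [map_smul, innerSL_apply_apply, smul_eq_mul]
    rw [fourierCoeff_congr_ae ef, L2.inner_def]
    congr 1
    refine integral_congr_ae ?_
    filter_upwards [eg, coeFn_fourierLp 2 k] with t h1 h2
    rw [h1, h2, RCLike.inner_apply]
  have e2 : ∫ t, f t * (starRingEnd ℂ) (g t) ∂muC = (innerSL ℂ hg.toLp) hf.toLp := by
    rw [innerSL_apply_apply, L2.inner_def]
    refine integral_congr_ae ?_
    filter_upwards [eg, ef] with t h1 h2
    rw [h1, h2, RCLike.inner_apply]
  rw [e1, e2]
  exact h2

lemma memLp_bdd {f : AddCircle (2 * π) → ℂ} (hf : Measurable f) (M : ℝ) (hM : ∀ t, ‖f t‖ ≤ M) :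
    MemLp f 2 muC :=
  MemLp.of_bound hf.aestronglyMeasurable M (Filter.Eventually.of_forall hM)

lemma integrable_bdd {E : Type*} [NormedAddCommGroup E] {X : Type*} [MeasurableSpace X]
    (ν : Measure X) [IsFiniteMeasure ν]
    {f : X → E} (hf : AEStronglyMeasurable f ν) (M : ℝ) (hM : ∀ t, ‖f t‖ ≤ M) :
    Integrable f ν :=
  Integrable.of_bound hf M (Filter.Eventually.of_forall hM)

lemma norm_fourier_one' (n : ℤ) (t : AddCircle (2 * π)) : ‖fourier n t‖ = 1 := by
  rw [fourier_apply]; exact Circle.norm_coe _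

lemma coeff_neg_real (U : AddCircle (2 * π) → ℝ) (k : ℤ) :
    fourierCoeff (fun t => (U t : ℂ)) (-k)
      = (starRingEnd ℂ) (fourierCoeff (fun t => (U t : ℂ)) k) := by
  rw [fourierCoeff, fourierCoeff, ← integral_conj]
  simp

lemma fourier_add_arg (k : ℤ) (s t : AddCircle (2 * π)) :
    fourier k (s + t) = fourier k s * fourier k t := by
  simp [fourier_apply, AddCircle.toCircle_add]

lemma coeff_shift (f : AddCircle (2 * π) → ℂ) (h : AddCircle (2 * π)) (k : ℤ) :
    fourierCoeff (fun t => f (t + h)) k = fourier k h * fourierCoeff f k := by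
  rw [fourierCoeff, fourierCoeff,
    ← integral_add_right_eq_self (fun t => fourier (-k) t • f t) h, ← integral_const_mul]
  refine integral_congr_ae (Filter.Eventually.of_forall fun t => ?_)
  simp only [smul_eq_mul]
  rw [fourier_add_arg]
  have : fourier k h * fourier (-k) h = 1 := by
    rw [← fourier_add]; simp
  linear_combination (- fourier (-k) t * f (t + h)) * this

lemma fejer_lower (k : ℕ) :
    (k : ℝ) ≤ ∫ h, ‖∑ j ∈ Finset.range k, fourier 1 h ^ j‖ ^ 2 ∂muC := by
  have hc : Continuous fun t : AddCircle (2 * π) => ∑ j ∈ Finset.range k, fourier 1 t ^ j := by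
    fun_prop
  have hp := parseval_memLp (fun t => ∑ j ∈ Finset.range k, fourier 1 t ^ j)
    (memLp_bdd hc.measurable k fun t => by
      refine (norm_sum_le _ _).trans ?_
      simp only [norm_pow, norm_fourier_one', one_pow]
      simp)
  have hs := sum_le_hasSum ((Finset.range k).map Nat.castEmbedding) (fun _ _ => by positivity) hp
  refine le_trans (le_of_eq ?_) hs
  rw [Finset.sum_map]
  have : ∀ i ∈ Finset.range k, ‖fourierCoeff
      (fun t : AddCircle (2 * π) => ∑ j ∈ Finset.range k, fourier 1 t ^ j)
      (Nat.castEmbedding i : ℤ)‖ ^ 2 = 1 := by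
    intro i hi
    have e : (fun t : AddCircle (2 * π) => ∑ j ∈ Finset.range k, fourier 1 t ^ j)
        = ∑ j ∈ Finset.range k, (fun t => fourier (j : ℤ) t) := by
      funext t
      rw [Finset.sum_apply]
      refine Finset.sum_congr rfl fun j _ => ?_
      rw [fourier_eq_zpow (j : ℤ), zpow_natCast]
    have e2 := fourierCoeff.sum (T := 2 * π) (Finset.range k)
      (fun j : ℕ => fun t : AddCircle (2 * π) => (fourier (j : ℤ) t : ℂ))
      (fun j _ => integrable_bdd _ (fourier (j : ℤ)).continuous.aestronglyMeasurable 1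
        fun t => (norm_fourier_one' _ t).le)
    rw [e, e2]
    simp only [Finset.sum_apply]
    rw [Finset.sum_eq_single i]
    · rw [fourierCoeff_fourier]; simp
    · intro j _ hj
      rw [fourierCoeff_fourier]
      simp [hj.symm]
    · intro h; exact absurd hi h
  rw [Finset.sum_congr rfl this]
  simp

lemma energy_lower (U : AddCircle (2 * π) → ℝ) (hU : Measurable U) (M : ℝ)
    (hM : ∀ t, |U t| ≤ M) (K : ℝ)
    (hK : ∀ s t, (U s - U t) ^ 2 / ‖fourier 1 s - fourier 1 t‖ ^ 2 ≤ K) (N : ℕ) :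
    ∑ k ∈ Finset.range N, k * ‖fourierCoeff (fun t => (U t : ℂ)) k‖ ^ 2
      ≤ 1 / 2 * ∫ s, ∫ t, (U s - U t) ^ 2 / ‖fourier 1 s - fourier 1 t‖ ^ 2 ∂muC ∂muC := by
  set G : AddCircle (2 * π) → AddCircle (2 * π) → ℝ :=
    fun s t => (U s - U t) ^ 2 / ‖fourier 1 s - fourier 1 t‖ ^ 2 with hG
  set c : ℕ → ℂ := fun k => fourierCoeff (fun t => (U t : ℂ)) k with hc
  have hGs : ∀ s h, G s (s + h) = (U (s + h) - U s) ^ 2 / ‖fourier 1 h - 1‖ ^ 2 := by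
    intro s h
    simp only [hG]
    have e1 : (fourier 1 s - fourier 1 (s + h) : ℂ) = - (fourier 1 s * (fourier 1 h - 1)) := by
      rw [fourier_add_arg]; ring
    rw [e1, norm_neg, norm_mul, norm_fourier_one', one_mul]
    congr 1
    ring
  have hGm : Measurable (Function.uncurry fun s h => G s (s + h)) := by
    simp only [hG]
    have m1 : Measurable fun p : AddCircle (2 * π) × AddCircle (2 * π) => p.1 + p.2 :=
      continuous_add.measurable
    have m2 : Measurable fun p : AddCircle (2 * π) => (fourier 1 p : ℂ) :=
      (fourier 1).continuous.measurable
    exact (((hU.comp measurable_fst).sub (hU.comp m1)).pow_const 2).div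
      (((m2.comp measurable_fst).sub (m2.comp m1)).norm.pow_const 2)
  have hGi : Integrable (Function.uncurry fun s h => G s (s + h)) (muC.prod muC) := by
    refine integrable_bdd _ hGm.aestronglyMeasurable K ?_
    rintro ⟨s, h⟩
    simp only [Function.uncurry]
    rw [Real.norm_of_nonneg (by simp only [hG]; positivity)]
    exact hK _ _
  have e1 : ∫ s, ∫ t, G s t ∂muC ∂muC = ∫ h, ∫ s, G s (s + h) ∂muC ∂muC := by
    rw [← integral_integral_swap hGi]
    refine integral_congr_ae (Filter.Eventually.of_forall fun s => ?_)
    exact (integral_add_left_eq_self (fun t => G s t) s).symm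
  have hUc : ∀ t, ‖(U t : ℂ)‖ ≤ M := fun t => by simpa using hM t
  have hUcm : Measurable fun t => (U t : ℂ) := Complex.measurable_ofReal.comp hU
  have bessel : ∀ h, 2 * ∑ k ∈ Finset.range N, ‖c k‖ ^ 2 * ‖fourier (k : ℤ) h - 1‖ ^ 2
      ≤ ∫ s, (U (s + h) - U s) ^ 2 ∂muC := by
    intro h
    have hm : Measurable fun s => ((U (s + h) : ℂ)) := hUcm.comp (measurable_add_const h)
    have hp := parseval_memLp (fun s => (U (s + h) : ℂ) - U s)
      (memLp_bdd (hm.sub hUcm) (M + M) fun s => (norm_sub_le _ _).trans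
        (add_le_add (hUc _) (hUc _)))
    have hcf : ∀ i : ℤ, fourierCoeff (fun s => (U (s + h) : ℂ) - U s) i
        = (fourier i h - 1) * fourierCoeff (fun t => (U t : ℂ)) i := by
      intro i
      have hi1 := (integrable_bdd muC hm.aestronglyMeasurable M fun s => hUc _)
      have hi2 := (integrable_bdd muC hUcm.aestronglyMeasurable M fun s => hUc _)
      have := coeff_shift (fun t => (U t : ℂ)) h i
      rw [sub_mul, ← this, one_mul]
      simp only [fourierCoeff, smul_sub]
      exact integral_sub (hi1.fourier_smul _) (hi2.fourier_smul _)
    have hp2 := hp.nat_add_neg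
    have hs := sum_le_hasSum (Finset.range N) (fun _ _ => by positivity) hp2
    simp only [hcf] at hs
    simp only [fourier_zero, sub_self, zero_mul, norm_zero] at hs
    have hR : ∫ s, (U (s + h) - U s) ^ 2 ∂muC = ∫ s, ‖(U (s + h) : ℂ) - U s‖ ^ 2 ∂muC := by
      congr 1
      funext s
      rw [← Complex.ofReal_sub, Complex.norm_real, Real.norm_eq_abs, sq_abs]
    rw [hR]
    refine le_trans (le_of_eq ?_) (hs.trans (le_of_eq (by ring)))
    rw [Finset.mul_sum]
    refine Finset.sum_congr rfl fun k _ => ?_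
    have e2 : ‖(fourier (-(k : ℤ)) h : ℂ) - 1‖ = ‖(fourier (k : ℤ) h : ℂ) - 1‖ := by
      rw [fourier_neg, ← RCLike.norm_conj]
      simp
    rw [coeff_neg_real, norm_mul, norm_mul, e2, RCLike.norm_conj]
    ring
  have e2 : ∫ h, 2 * ∑ k ∈ Finset.range N, ‖c k‖ ^ 2 *
      ‖∑ j ∈ Finset.range k, fourier 1 h ^ j‖ ^ 2 ∂muC ≤ ∫ h, ∫ s, G s (s + h) ∂muC ∂muC := by
    refine integral_mono_ae ?_ hGi.integral_prod_right ?_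
    · refine Continuous.integrable_of_hasCompactSupport (by fun_prop) (HasCompactSupport.of_compactSpace _)
    · have hne : ∀ᵐ h ∂muC, h ≠ 0 := by
        rw [ae_iff]; simpa using muC_singleton
      filter_upwards [hne] with h hh
      simp only [hGs]
      rw [integral_div]
      have hz : (fourier 1 h : ℂ) - 1 ≠ 0 := by
        intro h0
        apply hh
        have : (AddCircle.toCircle h : ℂ) = 1 := by
          rw [← fourier_one]; exact sub_eq_zero.1 h0
        have h3 : AddCircle.toCircle h = 1 := by
          apply Subtype.ext; simpa using this
        apply AddCircle.injective_toCircle (T := 2 * π) Real.two_pi_pos.ne'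
        rw [h3, AddCircle.toCircle_zero]
      have hz' : 0 < ‖(fourier 1 h : ℂ) - 1‖ ^ 2 := by positivity
      rw [le_div_iff₀ hz']
      refine le_trans (le_of_eq ?_) (bessel h)
      rw [mul_assoc, Finset.sum_mul]
      congr 1
      refine Finset.sum_congr rfl fun k _ => ?_
      rw [mul_assoc, ← mul_pow, ← norm_mul, geom_sum_mul, fourier_eq_zpow (k : ℤ), zpow_natCast]
  have e3 : 2 * ∑ k ∈ Finset.range N, k * ‖c k‖ ^ 2 ≤ ∫ h, 2 * ∑ k ∈ Finset.range N, ‖c k‖ ^ 2 *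
      ‖∑ j ∈ Finset.range k, fourier 1 h ^ j‖ ^ 2 ∂muC := by
    rw [integral_const_mul, integral_finsetSum]
    · gcongr with k hk
      rw [integral_const_mul, mul_comm]
      exact mul_le_mul_of_nonneg_left (fejer_lower k) (by positivity)
    · intro k _
      refine Continuous.integrable_of_hasCompactSupport (by fun_prop) (HasCompactSupport.of_compactSpace _)
  rw [e1]
  linarith

theorem circle_onofri (U : AddCircle (2 * π) → ℝ) (hU : Measurable U) (M : ℝ)
    (hM : ∀ t, |U t| ≤ M) (K : ℝ)
    (hK : ∀ s t, (U s - U t) ^ 2 / ‖fourier 1 s - fourier 1 t‖ ^ 2 ≤ K) :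
    ∫ t, Real.exp (U t) ∂muC ≤
      Real.exp (1 / 2 * (∫ s, ∫ t, (U s - U t) ^ 2 / ‖fourier 1 s - fourier 1 t‖ ^ 2 ∂muC ∂muC)
        + ∫ t, U t ∂muC) := by
  set E := 1 / 2 * (∫ s, ∫ t, (U s - U t) ^ 2 / ‖fourier 1 s - fourier 1 t‖ ^ 2 ∂muC ∂muC) with hE
  set u0 := ∫ t, U t ∂muC with hu0
  set fc : ℤ → ℂ := fun k => fourierCoeff (fun t => (U t : ℂ)) k with hfc
  have hfc0 : fc 0 = u0 := by
    rw [hu0, ← integral_complex_ofReal]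
    simp [hfc, fourierCoeff]
  set c : ℕ → ℂ := fun k => if k = 0 then 0 else fc k with hc
  have hUc : ∀ t, ‖(U t : ℂ)‖ ≤ M := fun t => by simpa using hM t
  have hUcm : Measurable fun t => (U t : ℂ) := Complex.measurable_ofReal.comp hU
  have hem : Measurable fun t => Real.exp (U t) := Real.measurable_exp.comp hU
  have heb : ∀ t, ‖Real.exp (U t)‖ ≤ Real.exp M := fun t => by
    rw [Real.norm_of_nonneg (Real.exp_pos _).le]
    exact Real.exp_le_exp.2 ((le_abs_self _).trans (hM t))
  have hei : Integrable (fun t => Real.exp (U t)) muC :=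
    integrable_bdd _ hem.aestronglyMeasurable _ heb
  have hecm : Measurable fun t => (Real.exp (U t) : ℂ) := Complex.measurable_ofReal.comp hem
  have hecb : ∀ t, ‖(Real.exp (U t) : ℂ)‖ ≤ Real.exp M := fun t => by
    rw [Complex.norm_real]; exact heb t
  -- products with bounded continuous functions are integrable
  have hmulc : ∀ f : AddCircle (2 * π) → ℝ, Continuous f →
      Integrable (fun t => Real.exp (U t) * f t) muC := by
    intro f hf
    exact (hf.integrable_of_hasCompactSupport (HasCompactSupport.of_compactSpace _)).bdd_mul
      hem.aestronglyMeasurable (Filter.Eventually.of_forall heb)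
  have hpair := (pairing_hasSum _ _ (memLp_bdd hUcm M hUc) (memLp_bdd hecm _ hecb)).nat_add_neg
  have hpairR := Complex.hasSum_re hpair
  set I0 := ∫ t, Real.exp (U t) ∂muC with hI0
  set I1 := ∫ t, Real.exp (U t) * U t ∂muC with hI1
  have hQ : HasSum (fun n : ℕ => ∫ t, Real.exp (U t) * (2 * (fc n * fourier (n : ℤ) t).re) ∂muC)
      (I1 + u0 * I0) := by
    have key : ∀ k : ℤ, (fourierCoeff (fun t => (U t : ℂ)) k *
        ∫ t, fourier k t * (starRingEnd ℂ) (Real.exp (U t) : ℂ) ∂muC).re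
        = ∫ t, Real.exp (U t) * (fc k * fourier k t).re ∂muC := by
      intro k
      have hintg : Integrable (fun t => fc k * (fourier k t * (starRingEnd ℂ) (Real.exp (U t) : ℂ)))
          muC := by
        have m1 : Measurable fun t : AddCircle (2 * π) => (fourier k t : ℂ) :=
          (fourier k).continuous.measurable
        have m2 : Measurable fun t : AddCircle (2 * π) =>
            fc k * (fourier k t * (starRingEnd ℂ) (Real.exp (U t) : ℂ)) := by
          simp only [Complex.conj_ofReal]
          exact (m1.mul hecm).const_mul _
        refine integrable_bdd _ m2.aestronglyMeasurable (‖fc k‖ * Real.exp M) fun t => ?_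
        rw [norm_mul, norm_mul, norm_fourier_one', one_mul, RCLike.norm_conj]
        exact mul_le_mul_of_nonneg_left (hecb t) (norm_nonneg _)
      rw [← integral_const_mul]
      have h1 := integral_re (𝕜 := ℂ) hintg
      simp only [RCLike.re_to_complex] at h1
      refine h1.symm.trans ?_
      congr 1
      funext t
      rw [Complex.conj_ofReal, ← Complex.re_ofReal_mul]
      congr 1
      ring
    have ea : (fun n : ℕ => ∫ t, Real.exp (U t) * (2 * (fc n * fourier (n : ℤ) t).re) ∂muC)
        = fun n : ℕ => (fourierCoeff (fun t => (U t : ℂ)) n *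
            (∫ t, fourier (n : ℤ) t * (starRingEnd ℂ) (Real.exp (U t) : ℂ) ∂muC) +
          fourierCoeff (fun t => (U t : ℂ)) (-n) *
            ∫ t, fourier (-(n : ℤ)) t * (starRingEnd ℂ) (Real.exp (U t) : ℂ) ∂muC).re := by
      funext n
      rw [Complex.add_re, key, key]
      have : ∀ t : AddCircle (2 * π), (fc (-n) * fourier (-(n : ℤ)) t).re = (fc n * fourier (n : ℤ) t).re := by
        intro t
        simp only [hfc]
        rw [coeff_neg_real, fourier_neg, ← map_mul, Complex.conj_re]
      simp only [this]
      rw [← two_mul, ← integral_const_mul]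
      congr 1
      funext t
      ring
    have eb : I1 + u0 * I0 = (∫ t, (U t : ℂ) * (starRingEnd ℂ) (Real.exp (U t) : ℂ) ∂muC +
        fourierCoeff (fun t => (U t : ℂ)) 0 *
        ∫ t, fourier 0 t * (starRingEnd ℂ) (Real.exp (U t) : ℂ) ∂muC).re := by
      rw [Complex.add_re, key]
      congr 1
      · have : ∀ t, (U t : ℂ) * (starRingEnd ℂ) (Real.exp (U t) : ℂ)
            = ((Real.exp (U t) * U t : ℝ) : ℂ) := by
          intro t; rw [Complex.conj_ofReal]; push_cast; ring
        simp only [this]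
        rw [integral_complex_ofReal, Complex.ofReal_re]
      · simp only [fourier_zero, hfc0, mul_one, Complex.ofReal_re]
        rw [integral_mul_const, mul_comm]
    rw [ea, eb]
    exact hpairR
  have hQ' : HasSum (fun n : ℕ => ∫ t, Real.exp (U t) * (2 * (c n * fourier (n : ℤ) t).re) ∂muC)
      (I1 - u0 * I0) := by
    have := hQ.sub (hasSum_ite_eq (0 : ℕ) (2 * u0 * I0))
    have ea : (fun n : ℕ => ∫ t, Real.exp (U t) * (2 * (c n * fourier (n : ℤ) t).re) ∂muC)
        = fun n : ℕ => (∫ t, Real.exp (U t) * (2 * (fc n * fourier (n : ℤ) t).re) ∂muC)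
          - if n = 0 then 2 * u0 * I0 else 0 := by
      funext n
      by_cases hn : n = 0
      · subst hn
        have c0 : c 0 = 0 := by simp [hc]
        simp only [c0, Nat.cast_zero, fourier_zero, hfc0, mul_one, Complex.ofReal_re, zero_mul,
          Complex.zero_re, mul_zero, integral_zero, if_true]
        rw [integral_mul_const, ← hI0]
        ring
      · simp [hc, hn]
    have eb : I1 - u0 * I0 = I1 + u0 * I0 - 2 * u0 * I0 := by ring
    rw [ea, eb]
    exact this
  have hT := hQ'.tendsto_sum_nat
  have hmain : ∀ N : ℕ, I0 ≤ Real.exp (E + u0)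
      - (∑ n ∈ Finset.range N, ∫ t, Real.exp (U t) * (2 * (c n * fourier (n : ℤ) t).re) ∂muC)
      - u0 * I0 + I1 := by
    intro N
    set f : AddCircle (2 * π) → ℂ := fun t => ∑ n ∈ Finset.range N, c n * fourier (n : ℤ) t with hf
    have hfcont : Continuous f := by rw [hf]; fun_prop
    have hsum : ∑ n ∈ Finset.range N, ∫ t, Real.exp (U t) * (2 * (c n * fourier (n : ℤ) t).re) ∂muC
        = ∫ t, Real.exp (U t) * (2 * (f t).re) ∂muC := by
      rw [← integral_finsetSum]
      · congr 1
        funext t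
        rw [hf]
        simp only [Complex.re_sum, Finset.mul_sum]
      · intro n _
        refine hmulc _ ?_
        fun_prop
    have hLM : ∫ t, Real.exp (u0 + 2 * (f t).re) ∂muC ≤ Real.exp (E + u0) := by
      have h1 := lebedev_milin (fun n => if n < N then c n else 0) N (by simp [hc])
        (fun k hk => by simp [hk])
      have h2 : ∀ t, ‖Complex.exp (∑ k ∈ Finset.range N, (if k < N then c k else 0)
          * (fourier 1 t) ^ k)‖ ^ 2 = Real.exp (2 * (f t).re) := by
        intro t
        have : ∑ k ∈ Finset.range N, (if k < N then c k else 0) * (fourier 1 t) ^ k = f t := by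
          rw [hf]
          refine Finset.sum_congr rfl fun k hk => ?_
          rw [if_pos (Finset.mem_range.1 hk), fourier_eq_zpow (k : ℤ), zpow_natCast]
        rw [this, Complex.norm_exp, ← Real.exp_nat_mul]
        norm_num
      simp only [h2] at h1
      have h3 : ∑ k ∈ Finset.range N, (k : ℝ) * ‖(if k < N then c k else 0)‖ ^ 2 ≤ E := by
        refine le_trans (le_of_eq ?_) (energy_lower U hU M hM K hK N)
        refine Finset.sum_congr rfl fun k hk => ?_
        rw [if_pos (Finset.mem_range.1 hk)]
        by_cases hk0 : k = 0
        · simp [hk0]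
        · simp [hc, hk0, hfc]
      simp only [Real.exp_add]
      rw [integral_const_mul, mul_comm]
      exact mul_le_mul_of_nonneg_right (h1.trans (Real.exp_le_exp.2 h3)) (Real.exp_pos _).le
    rw [hsum]
    have hiw : Integrable (fun t => Real.exp (u0 + 2 * (f t).re)) muC :=
      Continuous.integrable_of_hasCompactSupport (by fun_prop) (HasCompactSupport.of_compactSpace _)
    have hif := hmulc (fun t => 2 * (f t).re) (by fun_prop)
    have hiU : Integrable (fun t => Real.exp (U t) * U t) muC := by
      refine integrable_bdd _ (hem.mul hU).aestronglyMeasurable (Real.exp M * M) fun t => ?_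
      rw [norm_mul]
      exact mul_le_mul (heb t) (hM t) (norm_nonneg _) (Real.exp_pos _).le
    have hmono : ∫ t, (Real.exp (U t) + Real.exp (U t) * (2 * (f t).re)
        + Real.exp (U t) * u0 - Real.exp (U t) * U t) ∂muC
        ≤ ∫ t, Real.exp (u0 + 2 * (f t).re) ∂muC := by
      refine integral_mono (((hei.add hif).add (hei.mul_const u0)).sub hiU) hiw fun t => ?_
      have h1 := Real.add_one_le_exp (u0 + 2 * (f t).re - U t)
      have h2 : Real.exp (u0 + 2 * (f t).re)
          = Real.exp (U t) * Real.exp (u0 + 2 * (f t).re - U t) := by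
        rw [← Real.exp_add]; congr 1; ring
      simp only
      rw [h2]
      nlinarith [mul_le_mul_of_nonneg_left h1 (Real.exp_pos (U t)).le]
    have hA : Integrable (fun t => Real.exp (U t) + Real.exp (U t) * (2 * (f t).re)) muC :=
      hei.add hif
    have hB : Integrable (fun t => Real.exp (U t) + Real.exp (U t) * (2 * (f t).re)
        + Real.exp (U t) * u0) muC := hA.add (hei.mul_const u0)
    rw [integral_sub hB hiU, integral_add hA (hei.mul_const u0), integral_add hei hif,
      integral_mul_const] at hmono
    linarith
  have hlim := ((hT.const_sub (Real.exp (E + u0))).sub_const (u0 * I0)).add_const I1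
  have := ge_of_tendsto' hlim hmain
  linarith

/-- the point of the circle with stereographic coordinate `x` -/
noncomputable def stereoPt (x : ℝ) : AddCircle (2 * π) := ((2 * Real.arctan x : ℝ) : AddCircle (2 * π))

lemma stereo_re_im (x : ℝ) :
    (fourier 1 (stereoPt x) : ℂ).re = (1 - x ^ 2) / (1 + x ^ 2) ∧
    (fourier 1 (stereoPt x) : ℂ).im = 2 * x / (1 + x ^ 2) := by
  have hx : (1 + x ^ 2) ≠ 0 := by positivity
  rw [stereoPt, fourier_one_coe]
  have h1 : circleMap 0 1 (2 * Real.arctan x)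
      = Complex.exp ((2 * Real.arctan x : ℝ) * Complex.I) := by simp [circleMap]
  rw [h1, Complex.exp_ofReal_mul_I_re, Complex.exp_ofReal_mul_I_im]
  have hc := Real.cos_sq_arctan x
  have hs : Real.sin (Real.arctan x) = x * Real.cos (Real.arctan x) := by
    have := Real.tan_mul_cos (Real.cos_arctan_pos x).ne'
    rw [Real.tan_arctan] at this
    exact this.symm
  constructor
  · rw [Real.cos_two_mul, hc]; field_simp; ring
  · rw [Real.sin_two_mul, hs]
    have : 2 * (x * Real.cos (Real.arctan x)) * Real.cos (Real.arctan x)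
        = 2 * x * Real.cos (Real.arctan x) ^ 2 := by ring
    rw [this, hc]; field_simp

lemma fourier_pi : (fourier 1 ((π : ℝ) : AddCircle (2 * π)) : ℂ) = -1 := by
  rw [fourier_one_coe]; simp [circleMap]

lemma chord (x y : ℝ) : ‖(fourier 1 (stereoPt x) : ℂ) - fourier 1 (stereoPt y)‖ ^ 2
    = 4 * (x - y) ^ 2 / ((1 + x ^ 2) * (1 + y ^ 2)) := by
  have hx : (1 + x ^ 2) ≠ 0 := by positivity
  have hy : (1 + y ^ 2) ≠ 0 := by positivity
  obtain ⟨h1, h2⟩ := stereo_re_im x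
  obtain ⟨h3, h4⟩ := stereo_re_im y
  rw [Complex.sq_norm, Complex.normSq_apply, Complex.sub_re, Complex.sub_im, h1, h2, h3, h4]
  field_simp
  ring

lemma chord_pi (x : ℝ) : ‖(fourier 1 (stereoPt x) : ℂ) - fourier 1 ((π : ℝ) : AddCircle (2 * π))‖ ^ 2
    = 4 / (1 + x ^ 2) := by
  have hx : (1 + x ^ 2) ≠ 0 := by positivity
  obtain ⟨h1, h2⟩ := stereo_re_im x
  rw [fourier_pi, Complex.sq_norm, Complex.normSq_apply, Complex.sub_re, Complex.sub_im, h1, h2]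
  simp only [Complex.neg_re, Complex.neg_im, Complex.one_re, Complex.one_im]
  field_simp
  ring

lemma stereo_ne_pi (x : ℝ) : stereoPt x ≠ ((π : ℝ) : AddCircle (2 * π)) := by
  intro h
  have := chord_pi x
  rw [h] at this
  simp only [sub_self, norm_zero] at this
  have h2 : 0 < 4 / (1 + x ^ 2) := by positivity
  rw [← this] at h2
  norm_num at h2

lemma circle_cases (t : AddCircle (2 * π)) :
    t = ((π : ℝ) : AddCircle (2 * π)) ∨ ∃ x, t = stereoPt x := by
  obtain ⟨θ, hθ, rfl⟩ := (AddCircle.coe_image_Ioc_eq (2 * π) (-π)).symm.subset (Set.mem_univ t)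
  have h2 : θ ≤ π := by have := hθ.2; linarith
  rcases h2.eq_or_lt with rfl | h
  · left; rfl
  · right
    refine ⟨Real.tan (θ / 2), ?_⟩
    rw [stereoPt, Real.arctan_tan]
    · congr 1; ring
    · have := hθ.1; linarith
    · linarith

lemma cov (F : AddCircle (2 * π) → ℝ) :
    ∫ t, F t ∂muC = (1 / (2 * π)) * ∫ x : ℝ, F (stereoPt x) * (2 / (1 + x ^ 2)) := by
  have hd : ∀ x ∈ (Set.univ : Set ℝ), HasDerivWithinAt (fun x => 2 * Real.arctan x)
      (2 * (1 / (1 + x ^ 2))) Set.univ x := fun x _ =>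
    ((Real.hasDerivAt_arctan x).const_mul 2).hasDerivWithinAt
  have hinj : Set.InjOn (fun x => 2 * Real.arctan x) Set.univ := by
    intro x _ y _ h
    exact Real.arctan_injective (by simpa using h)
  have himg : (fun x => 2 * Real.arctan x) '' Set.univ = Set.Ioo (-π) π := by
    ext θ
    simp only [Set.image_univ, Set.mem_range, Set.mem_Ioo]
    constructor
    · rintro ⟨x, rfl⟩
      have h1 := Real.neg_pi_div_two_lt_arctan x
      have h2 := Real.arctan_lt_pi_div_two x
      constructor <;> linarith
    · rintro ⟨h1, h2⟩
      refine ⟨Real.tan (θ / 2), ?_⟩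
      rw [Real.arctan_tan] <;> linarith
  have h := integral_image_eq_integral_abs_deriv_smul MeasurableSet.univ hd hinj
    (fun θ : ℝ => F (θ : AddCircle (2 * π)))
  rw [himg, Measure.restrict_univ] at h
  rw [muC, AddCircle.integral_haarAddCircle, ← AddCircle.integral_preimage _ (-π)]
  have e : -π + 2 * π = π := by ring
  rw [e, integral_Ioc_eq_integral_Ioo, h, smul_eq_mul, one_div]
  congr 1
  refine integral_congr_ae (Filter.Eventually.of_forall fun x => ?_)
  simp only [smul_eq_mul, stereoPt]
  rw [abs_of_nonneg (by positivity)]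
  ring

/-- bound for the kernel -/
lemma kernel_bound (v : ℝ → ℝ) (hv : ContDiff ℝ (⊤ : ℕ∞) v) (hvs : HasCompactSupport v) :
    ∃ M K : ℝ, (∀ x, |v x| ≤ M) ∧ (∀ x, (v x) ^ 2 * (1 + x ^ 2) ≤ K) ∧
      ∀ x y, (v x - v y) ^ 2 * ((1 + x ^ 2) * (1 + y ^ 2)) ≤ K * (x - y) ^ 2 := by
  obtain ⟨M, hM⟩ := hv.continuous.bounded_above_of_compact_support hvs
  have hqs : HasCompactSupport fun x => x * v x := hvs.mul_left
  obtain ⟨Q, hQ⟩ := (continuous_id.mul hv.continuous).bounded_above_of_compact_support hqs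
  have hps : HasCompactSupport fun x => (1 + x ^ 2) * v x := hvs.mul_left
  have hpc : ContDiff ℝ (⊤ : ℕ∞) fun x => (1 + x ^ 2) * v x := by fun_prop
  obtain ⟨L, hL⟩ := hpc.lipschitzWith_of_hasCompactSupport hps (by simp)
  have hM' : ∀ x, |v x| ≤ M := hM
  have hQ' : ∀ x, |x * v x| ≤ Q := hQ
  have hL' : ∀ x y, |(1 + x ^ 2) * v x - (1 + y ^ 2) * v y| ≤ L * |x - y| := fun x y => by
    simpa [Real.dist_eq] using hL.dist_le_mul x y
  refine ⟨M, (L + 2 * Q) ^ 2 + 4 * M ^ 2 + Q ^ 2, hM', ?_, ?_⟩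
  · intro x
    have h1 : (v x) ^ 2 ≤ M ^ 2 := sq_le_sq' (abs_le.1 (hM' x)).1 (abs_le.1 (hM' x)).2
    have h2 : (x * v x) ^ 2 ≤ Q ^ 2 := sq_le_sq' (abs_le.1 (hQ' x)).1 (abs_le.1 (hQ' x)).2
    nlinarith [sq_nonneg (L + 2 * Q), sq_nonneg M]
  · intro x y
    have h1 : |(v x - v y) * (1 + x * y)| ≤ (L + 2 * Q) * |x - y| := by
      have e : (v x - v y) * (1 + x * y) = ((1 + x ^ 2) * v x - (1 + y ^ 2) * v y)
          - (x - y) * (x * v x + y * v y) := by ring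
      rw [e]
      refine (abs_sub _ _).trans ?_
      rw [abs_mul]
      have h3 := (abs_add_le (x * v x) (y * v y)).trans (add_le_add (hQ' x) (hQ' y))
      nlinarith [hL' x y, mul_le_mul_of_nonneg_left h3 (abs_nonneg (x - y))]
    have h2 : |v x - v y| ≤ 2 * M := by
      refine (abs_sub _ _).trans ?_
      linarith [hM' x, hM' y]
    have h1s : ((v x - v y) * (1 + x * y)) ^ 2 ≤ (L + 2 * Q) ^ 2 * (x - y) ^ 2 := by
      have := pow_le_pow_left₀ (abs_nonneg _) h1 2
      rw [sq_abs] at this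
      refine this.trans (le_of_eq ?_)
      rw [mul_pow, sq_abs]
    have h2s : (v x - v y) ^ 2 ≤ 4 * M ^ 2 := by
      have := pow_le_pow_left₀ (abs_nonneg _) h2 2
      rw [sq_abs] at this
      linarith
    have e : (v x - v y) ^ 2 * ((1 + x ^ 2) * (1 + y ^ 2))
        = ((v x - v y) * (1 + x * y)) ^ 2 + (v x - v y) ^ 2 * (x - y) ^ 2 := by ring
    rw [e]
    nlinarith [mul_le_mul_of_nonneg_right h2s (sq_nonneg (x - y)), mul_nonneg (sq_nonneg Q) (sq_nonneg (x - y))]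

open Classical in
/-- the function on the circle corresponding to `v` -/
noncomputable def circleFn (v : ℝ → ℝ) (t : AddCircle (2 * π)) : ℝ :=
  if t = ((π : ℝ) : AddCircle (2 * π)) then 0 else
    v ((fourier 1 t : ℂ).im / (1 + (fourier 1 t : ℂ).re))

lemma circleFn_stereo (v : ℝ → ℝ) (x : ℝ) : circleFn v (stereoPt x) = v x := by
  have hx : (1 + x ^ 2) ≠ 0 := by positivity
  rw [circleFn, if_neg (stereo_ne_pi x)]
  obtain ⟨h1, h2⟩ := stereo_re_im x
  rw [h1, h2]
  congr 1
  have : 1 + (1 - x ^ 2) / (1 + x ^ 2) = 2 / (1 + x ^ 2) := by field_simp; ring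
  rw [this]
  field_simp

lemma circleFn_pi (v : ℝ → ℝ) : circleFn v ((π : ℝ) : AddCircle (2 * π)) = 0 := by
  rw [circleFn, if_pos rfl]

lemma circleFn_measurable (v : ℝ → ℝ) (hv : Measurable v) : Measurable (circleFn v) := by
  have m : Measurable fun t : AddCircle (2 * π) => (fourier 1 t : ℂ) :=
    (fourier 1).continuous.measurable
  refine Measurable.ite (measurableSet_singleton _) measurable_const ?_
  exact hv.comp ((Complex.measurable_im.comp m).div
    (measurable_const.add (Complex.measurable_re.comp m)))

/-- Onofri's inequality on the real line (stereographic form of the boundary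
Moser–Trudinger–Onofri inequality on the unit disk). -/
theorem stmt_6 (v : ℝ → ℝ) (hv : ContDiff ℝ (⊤ : ℕ∞) v) (hvs : HasCompactSupport v) :
    Real.log ((1 / (2 * π)) * ∫ x : ℝ, Real.exp (v x) * (2 / (1 + x ^ 2))) ≤
      (1 / (8 * π ^ 2)) * (∫ x : ℝ, ∫ y : ℝ, (v x - v y) ^ 2 / (x - y) ^ 2)
        + (1 / (2 * π)) * ∫ x : ℝ, v x * (2 / (1 + x ^ 2)) := by
  obtain ⟨M, K, hM, hK1, hK2⟩ := kernel_bound v hv hvs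
  have hM0 : 0 ≤ M := (abs_nonneg _).trans (hM 0)
  have hK0 : 0 ≤ K := by
    have := hK1 0
    nlinarith [sq_nonneg (v 0)]
  have hU := circleFn_measurable v hv.continuous.measurable
  have hUM : ∀ t, |circleFn v t| ≤ M := by
    intro t
    rcases circle_cases t with rfl | ⟨x, rfl⟩
    · rw [circleFn_pi, abs_zero]; exact hM0
    · rw [circleFn_stereo]; exact hM x
  have hpi : ∀ x, (v x) ^ 2 / (4 / (1 + x ^ 2)) ≤ K := by
    intro x
    rw [div_div_eq_mul_div]
    have h1 : 0 ≤ (v x) ^ 2 * (1 + x ^ 2) := by positivity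
    linarith [hK1 x]
  have hUK : ∀ s t, (circleFn v s - circleFn v t) ^ 2 / ‖(fourier 1 s : ℂ) - fourier 1 t‖ ^ 2
      ≤ K := by
    intro s t
    rcases circle_cases s with rfl | ⟨x, rfl⟩ <;> rcases circle_cases t with rfl | ⟨y, rfl⟩
    · simpa using hK0
    · rw [norm_sub_rev, chord_pi, circleFn_pi, circleFn_stereo, zero_sub, neg_sq]
      exact hpi y
    · rw [chord_pi, circleFn_pi, circleFn_stereo, sub_zero]
      exact hpi x
    · rw [chord, circleFn_stereo, circleFn_stereo, div_div_eq_mul_div]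
      refine div_le_of_le_mul₀ (by positivity) hK0 ?_
      refine (hK2 x y).trans ?_
      nlinarith [mul_nonneg hK0 (sq_nonneg (x - y))]
  have main := circle_onofri (circleFn v) hU M hUM K hUK
  have e1 : ∫ t, Real.exp (circleFn v t) ∂muC
      = (1 / (2 * π)) * ∫ x : ℝ, Real.exp (v x) * (2 / (1 + x ^ 2)) := by
    rw [cov]; simp only [circleFn_stereo]
  have e2 : ∫ t, circleFn v t ∂muC = (1 / (2 * π)) * ∫ x : ℝ, v x * (2 / (1 + x ^ 2)) := by
    rw [cov]; simp only [circleFn_stereo]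
  have e3 : 1 / 2 * (∫ s, ∫ t, (circleFn v s - circleFn v t) ^ 2
        / ‖(fourier 1 s : ℂ) - fourier 1 t‖ ^ 2 ∂muC ∂muC)
      = (1 / (8 * π ^ 2)) * (∫ x : ℝ, ∫ y : ℝ, (v x - v y) ^ 2 / (x - y) ^ 2) := by
    rw [cov]
    simp only [cov (fun t => (circleFn v (stereoPt _) - circleFn v t) ^ 2
        / ‖(fourier 1 (stereoPt _) : ℂ) - fourier 1 t‖ ^ 2)]
    simp only [circleFn_stereo, chord]
    have hin : ∀ x : ℝ, 1 / (2 * π) * (∫ y : ℝ, (v x - v y) ^ 2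
        / (4 * (x - y) ^ 2 / ((1 + x ^ 2) * (1 + y ^ 2))) * (2 / (1 + y ^ 2))) * (2 / (1 + x ^ 2))
        = 1 / (2 * π) * ∫ y : ℝ, (v x - v y) ^ 2 / (x - y) ^ 2 := by
      intro x
      rw [mul_assoc, ← integral_mul_const]
      congr 1
      refine integral_congr_ae (Filter.Eventually.of_forall fun y => ?_)
      have hx : (1 + x ^ 2) ≠ 0 := by positivity
      have hy : (1 + y ^ 2) ≠ 0 := by positivity
      simp only
      by_cases hxy : x - y = 0
      · simp [hxy]
      · field_simp
        ring
    simp only [hin]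
    rw [integral_const_mul]
    have := Real.pi_pos.ne'
    field_simp
    ring
  rw [e1, e2, e3] at main
  have hpos : 0 < (1 / (2 * π)) * ∫ x : ℝ, Real.exp (v x) * (2 / (1 + x ^ 2)) := by
    rw [← e1]
    refine integral_exp_pos ?_
    refine integrable_bdd _ (Real.measurable_exp.comp hU).aestronglyMeasurable (Real.exp M)
      fun t => ?_
    rw [Real.norm_of_nonneg (Real.exp_pos _).le]
    exact Real.exp_le_exp.2 ((le_abs_self _).trans (hUM t))
  exact (Real.log_le_iff_le_exp hpos).2 main
end

section
/- There exists a sequence of smooth compactly supported functions ψ_k : ℝ → ℝ with 0 ≤ ψ_k ≤ 1 such that ψ_k → 1 uniformly on every compact subset of ℝ and ∫_ℝ∫_ℝ (ψ_k(x)−ψ_k(y))²/(x−y)² dx dy → 0 as k → ∞. -/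
open MeasureTheory Real

namespace CutoffAux

lemma sum_le (n : ℕ) : ∀ (d : ℕ → ℝ) (c : ℝ), (∀ j, 0 ≤ d j) →
    (∀ j, d j ≤ c * (1/2) ^ j) →
    (∑ j ∈ Finset.range n, d j ≤ 2 * c) ∧
    (∑ j ∈ Finset.range n, d j) ^ 2 ≤ ∑ j ∈ Finset.range n, 3 * (c * (1/2) ^ j) * d j := by
  induction n with
  | zero =>
    intro d c h0 h1
    have := h0 0
    have := h1 0
    simp at *
    linarith
  | succ n ih =>
    intro d c h0 h1
    obtain ⟨ha, hb⟩ := ih (fun j => d (j+1)) (c/2) (fun j => h0 _) (fun j => by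
      have := h1 (j+1)
      rw [pow_succ] at this
      linarith)
    rw [Finset.sum_range_succ', Finset.sum_range_succ']
    have e : ∑ j ∈ Finset.range n, 3 * (c * (1/2:ℝ) ^ (j+1)) * d (j+1)
        = ∑ j ∈ Finset.range n, 3 * (c/2 * (1/2) ^ j) * d (j+1) := by
      refine Finset.sum_congr rfl fun j _ => ?_
      rw [pow_succ]; ring
    rw [e]
    have p0 := h0 0
    have p1 := h1 0
    simp only [pow_zero, mul_one] at p1 ⊢
    refine ⟨by linarith, ?_⟩
    have hT : 0 ≤ ∑ j ∈ Finset.range n, d (j+1) := Finset.sum_nonneg fun j _ => h0 _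
    set T := ∑ j ∈ Finset.range n, d (j+1)
    nlinarith [mul_nonneg p0 (sub_nonneg.2 p1), mul_nonneg p0 (sub_nonneg.2 ha)]

lemma lint_scale (f : ℝ → ENNReal) (a : ℝ) (ha : 0 < a) :
    ∫⁻ x, f x = ENNReal.ofReal a * ∫⁻ x, f (a * x) := by
  conv_lhs => rw [← Real.smul_map_volume_mul_left ha.ne', abs_of_pos ha]
  rw [lintegral_smul_measure, smul_eq_mul]
  congr 1
  exact (measurableEmbedding_mulLeft₀ ha.ne').lintegral_map _

/-- the integrand of the W^{1/2,1} seminorm -/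
noncomputable def G (φ : ℝ → ℝ) (a : ℝ) (x y : ℝ) : ℝ :=
  |φ (x / a) - φ (y / a)| * (√|x - y| / (x - y) ^ 2)

lemma scale_G (φ : ℝ → ℝ) (b : ℝ) (hb : 0 < b) :
    ∫⁻ x, ∫⁻ y, ENNReal.ofReal (G φ (b ^ 2) x y) =
      ENNReal.ofReal b * ∫⁻ x, ∫⁻ y, ENNReal.ofReal (G φ 1 x y) := by
  have hb2 : 0 < b ^ 2 := by positivity
  rw [lint_scale _ _ hb2]
  have : ∀ x, ∫⁻ y, ENNReal.ofReal (G φ (b ^ 2) (b ^ 2 * x) y)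
      = ENNReal.ofReal (b⁻¹) * ∫⁻ y, ENNReal.ofReal (G φ 1 x y) := by
    intro x
    rw [lint_scale _ _ hb2, ← lintegral_const_mul' _ _ ENNReal.ofReal_ne_top,
      ← lintegral_const_mul' _ _ ENNReal.ofReal_ne_top]
    refine lintegral_congr fun y => ?_
    rw [← ENNReal.ofReal_mul hb2.le, ← ENNReal.ofReal_mul (by positivity)]
    congr 1
    unfold G
    rw [mul_div_cancel_left₀ _ hb2.ne', mul_div_cancel_left₀ _ hb2.ne', ← mul_sub, abs_mul,
      abs_of_pos hb2, Real.sqrt_mul hb2.le, Real.sqrt_sq hb.le, div_one, div_one, mul_pow]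
    by_cases h : x - y = 0
    · simp [h]
    · field_simp
  simp_rw [this]
  rw [lintegral_const_mul' _ _ ENNReal.ofReal_ne_top, ← mul_assoc,
    ← ENNReal.ofReal_mul hb2.le]
  congr 2
  field_simp

/-- dominating kernel -/
noncomputable def ker (L : ℝ) (h : ℝ) : ℝ := min 1 (L * |h|) * (√|h| / h ^ 2)

lemma ker_nonneg (L : ℝ) (hL : 0 ≤ L) (h : ℝ) : 0 ≤ ker L h := by
  unfold ker
  have : 0 ≤ min 1 (L * |h|) := le_min zero_le_one (by positivity)
  positivity

lemma ker_meas (L : ℝ) : Measurable (ker L) := by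
  unfold ker
  fun_prop

lemma ker_fin_pos (L : ℝ) (hL : 0 ≤ L) : ∫⁻ h in Set.Ioi 0, ENNReal.ofReal (ker L h) < ⊤ := by
  have h1 : IntegrableOn (fun t : ℝ => L * t ^ (-1/2 : ℝ)) (Set.Ioc 0 1) := by
    have := (intervalIntegral.intervalIntegrable_rpow' (a := 0) (b := 1)
      (r := -1/2) (by norm_num)).1
    exact this.const_mul L
  have h2 : IntegrableOn (fun t : ℝ => t ^ (-3/2 : ℝ)) (Set.Ioi 1) :=
    integrableOn_Ioi_rpow_of_lt (by norm_num) one_pos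
  have e1 : ∀ t : ℝ, 0 < t → t * (√t / t^2) = t ^ (-1/2 : ℝ) := by
    intro t ht
    rw [Real.sqrt_eq_rpow, ← Real.rpow_natCast t 2, ← Real.rpow_sub ht]
    nth_rw 1 [← Real.rpow_one t]
    rw [← Real.rpow_add ht]; norm_num
  have e2 : ∀ t : ℝ, 0 < t → (√t / t^2) = t ^ (-3/2 : ℝ) := by
    intro t ht
    rw [Real.sqrt_eq_rpow, ← Real.rpow_natCast t 2, ← Real.rpow_sub ht]
    norm_num
  rw [← Set.Ioc_union_Ioi_eq_Ioi (zero_le_one (α := ℝ))]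
  refine (lintegral_union_le _ _ _).trans_lt (ENNReal.add_lt_top.2 ⟨?_, ?_⟩)
  · refine lt_of_le_of_lt (setLIntegral_mono' measurableSet_Ioc fun t ht => ?_) h1.lintegral_lt_top
    refine ENNReal.ofReal_le_ofReal ?_
    unfold ker
    rw [abs_of_pos ht.1, ← e1 t ht.1, ← mul_assoc]
    exact mul_le_mul_of_nonneg_right (min_le_right _ _) (by positivity)
  · refine lt_of_le_of_lt (setLIntegral_mono' measurableSet_Ioi fun t ht => ?_) h2.lintegral_lt_top
    refine ENNReal.ofReal_le_ofReal ?_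
    have ht0 : (0:ℝ) < t := lt_trans one_pos ht
    unfold ker
    rw [abs_of_pos ht0, ← e2 t ht0]
    exact mul_le_of_le_one_left (by positivity) (min_le_left _ _)

lemma ker_fin (L : ℝ) (hL : 0 ≤ L) : ∫⁻ h, ENNReal.ofReal (ker L h) < ⊤ := by
  have hp := ker_fin_pos L hL
  rw [← lintegral_indicator measurableSet_Ioi] at hp
  set g := (Set.Ioi (0:ℝ)).indicator fun h => ENNReal.ofReal (ker L h) with hg
  have gm : Measurable g := (ker_meas L).ennreal_ofReal.indicator measurableSet_Ioi
  have : ∀ h, ENNReal.ofReal (ker L h) ≤ g h + g (-h) := by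
    intro h
    rcases lt_trichotomy h 0 with h0 | h0 | h0
    · have : g (-h) = ENNReal.ofReal (ker L h) := by
        rw [hg, Set.indicator_of_mem (by simpa using h0)]
        simp [ker]
      rw [this]; exact le_add_self
    · simp [h0, ker]
    · have : g h = ENNReal.ofReal (ker L h) := by
        rw [hg, Set.indicator_of_mem (by simpa using h0)]
      rw [this]; exact le_self_add
  refine (lintegral_mono this).trans_lt ?_
  rw [lintegral_add_left gm, lintegral_neg_eq_self]
  exact ENNReal.add_lt_top.2 ⟨hp, hp⟩

lemma G_fin (φ : ℝ → ℝ) (L : ℝ) (hL : 0 ≤ L) (h01 : ∀ x, 0 ≤ φ x ∧ φ x ≤ 1)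
    (hlip : ∀ x y, |φ x - φ y| ≤ L * |x - y|) (hs : ∀ x, x ∉ Set.Icc (-2:ℝ) 2 → φ x = 0) :
    ∫⁻ x, ∫⁻ y, ENNReal.ofReal (G φ 1 x y) < ⊤ := by
  set I : ℝ → ENNReal := (Set.Icc (-2:ℝ) 2).indicator 1 with hI
  have Im : Measurable I := measurable_one.indicator measurableSet_Icc
  have If : ∀ x, I x ≠ ⊤ := by
    intro x
    by_cases hx : x ∈ Set.Icc (-2:ℝ) 2
    · simp only [hI, Set.indicator_of_mem hx, Pi.one_apply]; exact ENNReal.one_ne_top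
    · simp only [hI, Set.indicator_of_notMem hx]; exact ENNReal.zero_ne_top
  have Iint : ∫⁻ x, I x = 4 := by
    rw [hI, lintegral_indicator_one measurableSet_Icc, Real.volume_Icc]
    norm_num
  have km := (ker_meas L).ennreal_ofReal
  set K := ∫⁻ h, ENNReal.ofReal (ker L h) with hK
  have Kfin : K < ⊤ := ker_fin L hL
  have b : ∀ x y, ENNReal.ofReal (G φ 1 x y) ≤
      I x * ENNReal.ofReal (ker L (x - y)) + I y * ENNReal.ofReal (ker L (x - y)) := by
    intro x y
    have hk : ENNReal.ofReal (G φ 1 x y) ≤ ENNReal.ofReal (ker L (x - y)) := by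
      refine ENNReal.ofReal_le_ofReal ?_
      unfold G ker
      refine mul_le_mul_of_nonneg_right (le_min ?_ ?_) (by positivity)
      · rw [abs_le]
        constructor <;> linarith [h01 (x/1), h01 (y/1)]
      · simpa using hlip x y
    by_cases hx : x ∈ Set.Icc (-2:ℝ) 2
    · refine hk.trans ?_
      have : I x = 1 := by simp only [hI, Set.indicator_of_mem hx, Pi.one_apply]
      rw [this, one_mul]; exact le_self_add
    by_cases hy : y ∈ Set.Icc (-2:ℝ) 2
    · refine hk.trans ?_
      have : I y = 1 := by simp only [hI, Set.indicator_of_mem hy, Pi.one_apply]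
      rw [this, one_mul]; exact le_add_self
    · have : G φ 1 x y = 0 := by simp [G, hs x hx, hs y hy]
      simp [this]
  have m1 : Measurable (Function.uncurry fun x y : ℝ => I x * ENNReal.ofReal (ker L (x - y))) :=
    (Im.comp measurable_fst).mul (km.comp (measurable_fst.sub measurable_snd))
  have m2 : Measurable (Function.uncurry fun x y : ℝ => I y * ENNReal.ofReal (ker L (x - y))) :=
    (Im.comp measurable_snd).mul (km.comp (measurable_fst.sub measurable_snd))
  calc ∫⁻ x, ∫⁻ y, ENNReal.ofReal (G φ 1 x y)
      ≤ ∫⁻ x, ∫⁻ y, (I x * ENNReal.ofReal (ker L (x - y)) + I y * ENNReal.ofReal (ker L (x - y))) :=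
        lintegral_mono fun x => lintegral_mono fun y => b x y
    _ = (∫⁻ x, ∫⁻ y, I x * ENNReal.ofReal (ker L (x - y)))
        + ∫⁻ x, ∫⁻ y, I y * ENNReal.ofReal (ker L (x - y)) := by
        rw [← lintegral_add_left (f := fun x => ∫⁻ y, I x * ENNReal.ofReal (ker L (x - y)))
          m1.lintegral_prod_right']
        refine lintegral_congr fun x => ?_
        exact lintegral_add_left (m1.comp measurable_prodMk_left) _
    _ = 4 * K + 4 * K := by
        congr 1
        · have : ∀ x, ∫⁻ y, I x * ENNReal.ofReal (ker L (x - y)) = I x * K := by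
            intro x
            rw [lintegral_const_mul' _ _ (If x),
              lintegral_sub_left_eq_self (fun h => ENNReal.ofReal (ker L h)) x]
          simp_rw [this]
          rw [lintegral_mul_const _ Im, Iint]
        · rw [lintegral_lintegral_swap m2.aemeasurable]
          have : ∀ y, ∫⁻ x, I y * ENNReal.ofReal (ker L (x - y)) = I y * K := by
            intro y
            rw [lintegral_const_mul' _ _ (If y),
              lintegral_sub_right_eq_self (fun h => ENNReal.ofReal (ker L h)) y]
          simp_rw [this]
          rw [lintegral_mul_const _ Im, Iint]
    _ < ⊤ := by
        have : 4 * K < ⊤ := ENNReal.mul_lt_top (by norm_num) Kfin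
        exact ENNReal.add_lt_top.2 ⟨this, this⟩

/-- averaged cutoffs -/
noncomputable def psi (φ : ℝ → ℝ) (k : ℕ) (x : ℝ) : ℝ :=
  ((k:ℝ) + 1)⁻¹ * ∑ j ∈ Finset.range (k+1), φ (x / (2 ^ (k + j)) ^ 2)

lemma pointwise (φ : ℝ → ℝ) (L : ℝ) (hL : 0 ≤ L) (h01 : ∀ x, 0 ≤ φ x ∧ φ x ≤ 1)
    (hlip : ∀ x y, |φ x - φ y| ≤ L * |x - y|) (k : ℕ) (x y : ℝ) :
    (psi φ k x - psi φ k y) ^ 2 / (x - y) ^ 2 ≤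
      ∑ j ∈ Finset.range (k+1),
        (((k:ℝ)+1)⁻¹ ^ 2 * (3 * √L) * (1/2) ^ (k+j)) * G φ ((2 ^ (k + j)) ^ 2) x y := by
  have hd : ∀ u v, |φ u - φ v| ≤ √(L * |u - v|) := by
    intro u v
    apply Real.le_sqrt_of_sq_le
    have h1 : |φ u - φ v| ≤ 1 := by
      rw [abs_le]
      constructor <;> linarith [h01 u, h01 v]
    have := hlip u v
    nlinarith [abs_nonneg (φ u - φ v)]
  set d : ℕ → ℝ := fun j => |φ (x / (2 ^ (k + j)) ^ 2) - φ (y / (2 ^ (k + j)) ^ 2)| with hdd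
  have hs := (sum_le (k+1) d (√L * √|x - y| * (1/2) ^ k) (fun j => abs_nonneg _) (fun j => by
    refine (hd _ _).trans (le_of_eq ?_)
    rw [← sub_div, abs_div, ← mul_div_assoc, Real.sqrt_div (by positivity), Real.sqrt_mul hL,
      abs_of_pos (a := ((2:ℝ) ^ (k + j)) ^ 2) (by positivity), Real.sqrt_sq (by positivity), mul_assoc _ (_ ^ k), ← pow_add,
      one_div, inv_pow, div_eq_mul_inv])).2
  have hdiff : (psi φ k x - psi φ k y) ^ 2 ≤ ((k:ℝ)+1)⁻¹ ^ 2 * (∑ j ∈ Finset.range (k+1), d j) ^ 2 := by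
    unfold psi
    rw [← mul_sub, mul_pow, ← Finset.sum_sub_distrib]
    refine mul_le_mul_of_nonneg_left ?_ (by positivity)
    rw [← sq_abs]
    exact pow_le_pow_left₀ (abs_nonneg _) (Finset.abs_sum_le_sum_abs _ _) 2
  calc (psi φ k x - psi φ k y) ^ 2 / (x - y) ^ 2
      ≤ (((k:ℝ)+1)⁻¹ ^ 2 * ∑ j ∈ Finset.range (k+1),
          3 * (√L * √|x - y| * (1/2) ^ k * (1/2) ^ j) * d j) / (x - y) ^ 2 := by
        refine div_le_div_of_nonneg_right (hdiff.trans ?_) (by positivity)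
        exact mul_le_mul_of_nonneg_left hs (by positivity)
    _ = _ := by
        rw [Finset.mul_sum, Finset.sum_div]
        refine Finset.sum_congr rfl fun j _ => ?_
        simp only [G, hdd, pow_add]
        ring

lemma G_meas (φ : ℝ → ℝ) (hc : Measurable φ) (a : ℝ) :
    Measurable (Function.uncurry fun x y => ENNReal.ofReal (G φ a x y)) := by
  unfold G Function.uncurry
  fun_prop

lemma bound (φ : ℝ → ℝ) (hc : Measurable φ) (L : ℝ) (hL : 0 ≤ L) (h01 : ∀ x, 0 ≤ φ x ∧ φ x ≤ 1)
    (hlip : ∀ x y, |φ x - φ y| ≤ L * |x - y|) (k : ℕ) :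
    ‖∫ x, ∫ y, (psi φ k x - psi φ k y) ^ 2 / (x - y) ^ 2‖ₑ ≤
      ENNReal.ofReal (((k:ℝ)+1)⁻¹ * (3 * √L)) * ∫⁻ x, ∫⁻ y, ENNReal.ofReal (G φ 1 x y) := by
  set Z := ∫⁻ x, ∫⁻ y, ENNReal.ofReal (G φ 1 x y) with hZ
  set C : ℕ → ℝ := fun j => (((k:ℝ)+1)⁻¹ ^ 2 * (3 * √L) * (1/2) ^ (k+j)) with hC
  have C0 : ∀ j, 0 ≤ C j := fun j => by positivity
  have G0 : ∀ a x y, 0 ≤ G φ a x y := fun a x y => by unfold G; positivity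
  calc ‖∫ x, ∫ y, (psi φ k x - psi φ k y) ^ 2 / (x - y) ^ 2‖ₑ
      ≤ ∫⁻ x, ∫⁻ y, ‖(psi φ k x - psi φ k y) ^ 2 / (x - y) ^ 2‖ₑ :=
        (enorm_integral_le_lintegral_enorm _).trans
          (lintegral_mono fun x => enorm_integral_le_lintegral_enorm _)
    _ ≤ ∫⁻ x, ∫⁻ y, ∑ j ∈ Finset.range (k+1),
          ENNReal.ofReal (C j) * ENNReal.ofReal (G φ ((2 ^ (k + j)) ^ 2) x y) := by
        refine lintegral_mono fun x => lintegral_mono fun y => ?_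
        dsimp only
        rw [Real.enorm_of_nonneg (by positivity)]
        refine (ENNReal.ofReal_le_ofReal (pointwise φ L hL h01 hlip k x y)).trans (le_of_eq ?_)
        rw [ENNReal.ofReal_sum_of_nonneg (fun j _ => mul_nonneg (C0 j) (G0 _ _ _))]
        exact Finset.sum_congr rfl fun j _ => ENNReal.ofReal_mul (C0 j)
    _ = ∑ j ∈ Finset.range (k+1), ENNReal.ofReal (C j) *
          ∫⁻ x, ∫⁻ y, ENNReal.ofReal (G φ ((2 ^ (k + j)) ^ 2) x y) := by
        have : ∀ x, ∫⁻ y, ∑ j ∈ Finset.range (k+1),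
            ENNReal.ofReal (C j) * ENNReal.ofReal (G φ ((2 ^ (k + j)) ^ 2) x y)
            = ∑ j ∈ Finset.range (k+1), ENNReal.ofReal (C j) *
              ∫⁻ y, ENNReal.ofReal (G φ ((2 ^ (k + j)) ^ 2) x y) := by
          intro x
          rw [lintegral_finsetSum]
          · exact Finset.sum_congr rfl fun j _ =>
              lintegral_const_mul' _ _ ENNReal.ofReal_ne_top
          · intro j _
            exact ((G_meas φ hc _).comp measurable_prodMk_left).const_mul _
        simp_rw [this]
        rw [lintegral_finsetSum]
        · exact Finset.sum_congr rfl fun j _ =>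
              lintegral_const_mul' _ _ ENNReal.ofReal_ne_top
        · intro j _
          exact ((G_meas φ hc _).lintegral_prod_right').const_mul _
    _ = ∑ j ∈ Finset.range (k+1), ENNReal.ofReal (((k:ℝ)+1)⁻¹ ^ 2 * (3 * √L)) * Z := by
        refine Finset.sum_congr rfl fun j _ => ?_
        rw [scale_G φ _ (by positivity), ← mul_assoc, ← ENNReal.ofReal_mul (C0 j)]
        congr 2
        simp only [hC]
        rw [mul_assoc, ← mul_pow]
        norm_num
    _ = _ := by
        rw [Finset.sum_const, Finset.card_range, nsmul_eq_mul, ← mul_assoc,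
          ← ENNReal.ofReal_natCast, ← ENNReal.ofReal_mul (by positivity)]
        congr 2
        push_cast
        field_simp

end CutoffAux

open CutoffAux in
/-- There is a sequence of smooth, compactly supported cutoffs `ψ_k` with values in `[0,1]`,
converging to `1` locally uniformly, whose `H^{1/2}` Gagliardo seminorms tend to zero. -/
theorem stmt_16 :
    ∃ ψ : ℕ → ℝ → ℝ,
      (∀ k, ContDiff ℝ (⊤ : ℕ∞) (ψ k)) ∧
      (∀ k, HasCompactSupport (ψ k)) ∧
      (∀ k x, 0 ≤ ψ k x ∧ ψ k x ≤ 1) ∧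
      (∀ K : Set ℝ, IsCompact K →
        TendstoUniformlyOn (fun k x => ψ k x) (fun _ => 1) Filter.atTop K) ∧
      Filter.Tendsto (fun k => ∫ x : ℝ, ∫ y : ℝ, (ψ k x - ψ k y) ^ 2 / (x - y) ^ 2)
        Filter.atTop (nhds 0) := by
  let φ : ContDiffBump (0:ℝ) := ⟨1, 2, one_pos, one_lt_two⟩
  have hsm : ContDiff ℝ (⊤ : ℕ∞) φ := φ.contDiff
  have h01 : ∀ x, 0 ≤ φ x ∧ φ x ≤ 1 := fun x => ⟨φ.nonneg, φ.le_one⟩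
  have h1 : ∀ x, |x| ≤ 1 → φ x = 1 := fun x hx =>
    φ.one_of_mem_closedBall (by simpa using hx)
  have hs : ∀ x, x ∉ Set.Icc (-2:ℝ) 2 → φ x = 0 := fun x hx =>
    φ.zero_of_le_dist (by
      rw [Real.dist_eq, sub_zero]
      by_contra! h
      exact hx ⟨(abs_lt.1 h).1.le, (abs_lt.1 h).2.le⟩)
  obtain ⟨L, hL⟩ := ContDiff.lipschitzWith_of_hasCompactSupport φ.hasCompactSupport hsm (by simp)
  have hlip : ∀ x y, |φ x - φ y| ≤ (L:ℝ) * |x - y| := fun x y => by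
    simpa [Real.dist_eq] using hL.dist_le_mul x y
  have hfin := G_fin φ L L.2 h01 hlip hs
  refine ⟨psi φ, ?_, ?_, ?_, ?_, ?_⟩
  · intro k
    unfold psi
    refine contDiff_const.mul (ContDiff.sum fun j _ => hsm.comp (contDiff_id.div_const _))
  · intro k
    refine HasCompactSupport.of_support_subset_isCompact
      (isCompact_Icc (a := -(2 * (2 ^ (k + k)) ^ 2 : ℝ)) (b := 2 * (2 ^ (k + k)) ^ 2)) ?_
    intro x hx
    by_contra hn
    apply hx
    unfold psi
    rw [Finset.sum_eq_zero, mul_zero]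
    intro j hj
    apply hs
    intro hm
    apply hn
    have hjk : j ≤ k := by
      have := Finset.mem_range.1 hj
      omega
    have hp : (0:ℝ) < (2 ^ (k + j)) ^ 2 := by positivity
    have hle : ((2:ℝ) ^ (k + j)) ^ 2 ≤ (2 ^ (k + k)) ^ 2 := by
      gcongr
      norm_num
    have ha := (le_div_iff₀ hp).1 hm.1
    have hb := (div_le_iff₀ hp).1 hm.2
    constructor <;> linarith
  · intro k x
    unfold psi
    have hk : (0:ℝ) < k + 1 := by positivity
    constructor
    · exact mul_nonneg (by positivity) (Finset.sum_nonneg fun j _ => (h01 _).1)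
    · rw [inv_mul_le_iff₀ hk, mul_one]
      refine (Finset.sum_le_card_nsmul _ _ 1 fun j _ => (h01 _).2).trans ?_
      simp
  · intro K hK
    obtain ⟨M, hM⟩ := hK.isBounded.exists_norm_le
    obtain ⟨n, hn⟩ := pow_unbounded_of_one_lt M (one_lt_two (α := ℝ))
    rw [Metric.tendstoUniformlyOn_iff]
    intro ε hε
    filter_upwards [Filter.eventually_ge_atTop n] with k hk x hx
    have : psi φ k x = 1 := by
      unfold psi
      rw [Finset.sum_congr rfl (g := fun _ => (1:ℝ))]
      · simp
        field_simp
      · intro j _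
        apply h1
        rw [abs_div, abs_of_pos (a := ((2:ℝ) ^ (k+j))^2) (by positivity),
          div_le_one (by positivity)]
        have a1 : |x| ≤ M := hM x hx
        have a2 : (2:ℝ) ^ n ≤ 2 ^ (k + j) := pow_le_pow_right₀ (by norm_num) (by omega)
        have a3 : (1:ℝ) ≤ 2 ^ (k + j) := one_le_pow₀ (by norm_num)
        nlinarith
    rw [this]
    simpa using hε
  · have hb := bound φ hsm.continuous.measurable L L.2 h01 hlip
    rw [tendsto_iff_enorm_sub_tendsto_zero]
    simp only [sub_zero]
    refine tendsto_of_tendsto_of_tendsto_of_le_of_le tendsto_const_nhds ?_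
      (fun _ => bot_le) hb
    have t1 : Filter.Tendsto (fun k : ℕ => ((k:ℝ)+1)⁻¹ * (3 * √(L:ℝ))) Filter.atTop (nhds 0) := by
      have := (tendsto_one_div_add_atTop_nhds_zero_nat (𝕜 := ℝ)).mul_const (3 * √(L:ℝ))
      simpa using this
    have t2 := ENNReal.Tendsto.mul_const (ENNReal.tendsto_ofReal t1) (Or.inr hfin.ne)
    simpa using t2
end
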